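/- Let I₀ ⊂ ℝ be an interval, f ∈ C³(I₀), and C_f := {(x, f(x)) : x ∈ I₀}. Assume there exists at least one point x₀ ∈ I₀ with f''(x₀) ≠ 0. Let s ∈ (1/2, 1) and let ψ be an approximating function. If ∑_{h=1}^∞ h^{1−s} ψ(h)^{s+1} = ∞, then ℋ^s(C_f ∩ S₂(ψ)) = ∞. -/

import Mathlib

open MeasureTheory Filter

/-- The distance from a real number to the nearest integer. -/
noncomputable def distNearestInt (x : ℝ) : ℝ := |x - round x|

/-- An approximating function: a decreasing function `ℝ₊ → ℝ₊` taking positive values. -/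
def IsApproxFun (ψ : ℝ → ℝ) : Prop :=
  (∀ x y : ℝ, 0 < x → x ≤ y → ψ y ≤ ψ x) ∧ ∀ x : ℝ, 0 < x → 0 < ψ x

/-- The set `S₂(ψ)` of simultaneously `ψ`-approximable points of the plane. -/
def SimApprox2 (ψ : ℝ → ℝ) : Set (ℝ × ℝ) :=
  {y : ℝ × ℝ |
    {q : ℕ | 0 < q ∧
      max (distNearestInt (q * y.1)) (distNearestInt (q * y.2)) < ψ q}.Infinite}

section Sublevel

open Set

theorem volume_le_of_forall_abs_sub_le {S : Set ℝ} {δ : ℝ}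
    (h : ∀ x ∈ S, ∀ y ∈ S, x ≤ y → y - x ≤ δ) : volume S ≤ ENNReal.ofReal δ := by
  refine (Real.volume_le_diam S).trans (Metric.ediam_le fun x hx y hy => ?_)
  rw [edist_dist, Real.dist_eq]
  apply ENNReal.ofReal_le_ofReal
  rcases le_total x y with hxy | hxy
  · rw [abs_sub_comm, abs_of_nonneg (by linarith)]
    exact h x hx y hy hxy
  · rw [abs_of_nonneg (by linarith)]
    exact h y hy x hx hxy

/-- A function whose increments on `S` are at least `m * (y - x)` is small only on a small set. -/
theorem volume_sublevel_le_of_slope_ge {F : ℝ → ℝ} {S : Set ℝ} {δ m : ℝ} (hm : 0 < m)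
    (h : ∀ x ∈ S, ∀ y ∈ S, x ≤ y → m * (y - x) ≤ |F y - F x|) :
    volume (S ∩ {x | |F x| < δ}) ≤ ENNReal.ofReal (2 * δ / m) := by
  apply volume_le_of_forall_abs_sub_le
  rintro x ⟨hx, hx'⟩ y ⟨hy, hy'⟩ hxy
  have h1 := h x hx y hy hxy
  have h2 : |F y - F x| ≤ |F y| + |F x| := abs_sub _ _
  simp only [mem_ofPred_eq] at hx' hy'
  rw [le_div_iff₀ hm]
  linarith

theorem volume_sublevel_le_of_slope_mem {L : ℝ → ℝ} {l r m M lam S κ : ℝ} (hlr : l < r)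
    (hm : 0 < m) (hmM : m ≤ M) (hlam : 0 ≤ lam)
    (hL : ∀ x ∈ Icc l r, ∀ y ∈ Icc l r, x ≤ y →
      m * lam * (y - x) ≤ L y - L x ∧ L y - L x ≤ M * lam * (y - x))
    (hκ : 0 < κ) (hκ' : κ ≤ 1 / 2) (hS : 0 < S) (hy : ∃ y ∈ Icc l r, S ≤ |L y|) :
    volume (Icc l r ∩ {x | |L x| < κ * S}) ≤ ENNReal.ofReal (4 * (M / m) * κ * (r - l)) := by
  rcases (Icc l r ∩ {x | |L x| < κ * S}).eq_empty_or_nonempty with he | ⟨y₁, hy₁, hy₁'⟩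
  · rw [he]; simp
  obtain ⟨y₀, hy₀, hy₀'⟩ := hy
  simp only [mem_ofPred_eq] at hy₁'
  have hdiff : S / 2 ≤ M * lam * (r - l) := by
    have h1 : S / 2 ≤ |L y₀ - L y₁| := by
      have := abs_sub_abs_le_abs_sub (L y₀) (L y₁)
      nlinarith
    have h2 : |L y₀ - L y₁| ≤ M * lam * (r - l) := by
      have hMl : 0 ≤ M * lam := mul_nonneg (hm.le.trans hmM) hlam
      have hml : 0 ≤ m * lam := mul_nonneg hm.le hlam
      rcases le_total y₀ y₁ with h | h
      · have := hL y₀ hy₀ y₁ hy₁ h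
        have h0 : 0 ≤ m * lam * (y₁ - y₀) := mul_nonneg hml (by linarith)
        rw [abs_sub_comm, abs_of_nonneg (by linarith)]
        exact this.2.trans (mul_le_mul_of_nonneg_left (by linarith [hy₀.1, hy₁.2]) hMl)
      · have := hL y₁ hy₁ y₀ hy₀ h
        have h0 : 0 ≤ m * lam * (y₀ - y₁) := mul_nonneg hml (by linarith)
        rw [abs_of_nonneg (by linarith)]
        exact this.2.trans (mul_le_mul_of_nonneg_left (by linarith [hy₁.1, hy₀.2]) hMl)
    exact h1.trans h2
  have hM : 0 < M := hm.trans_le hmM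
  have hrl : 0 < r - l := by linarith
  have hlam' : 0 < lam := by
    rcases hlam.eq_or_lt with h | h
    · rw [← h] at hdiff; simp at hdiff; linarith
    · exact h
  refine (volume_sublevel_le_of_slope_ge (m := m * lam) (by positivity)
    fun x hx y hy hxy => (hL x hx y hy hxy).1.trans (le_abs_self _)).trans ?_
  apply ENNReal.ofReal_le_ofReal
  rw [div_le_iff₀ (by positivity)]
  have : 4 * (M / m) * κ * (r - l) * (m * lam) = 4 * κ * (M * lam * (r - l)) := by
    field_simp
  rw [this]
  nlinarith

theorem volume_sublevel_le_of_hasDerivAt_mul {F L w : ℝ → ℝ} {l r m M lam S κ : ℝ}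
    (hlr : l < r) (hm : 0 < m) (hmM : m ≤ M) (hlam : 0 ≤ lam)
    (hF : ∀ x ∈ Icc l r, HasDerivAt F (w x * L x) x)
    (hw : ∀ x ∈ Icc l r, m ≤ w x ∧ w x ≤ M)
    (hL : ∀ x ∈ Icc l r, ∀ y ∈ Icc l r, x ≤ y →
      m * lam * (y - x) ≤ L y - L x ∧ L y - L x ≤ M * lam * (y - x))
    (hκ : 0 < κ) (hκ' : κ ≤ 1 / 4) (hS : 0 < S) (hy : ∃ y ∈ Icc l r, S ≤ |F y|) :
    volume (Icc l r ∩ {x | |F x| < κ * S}) ≤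
      ENNReal.ofReal (12 * (M / m) * √κ * (r - l)) := by
  rcases (Icc l r ∩ {x | |F x| < κ * S}).eq_empty_or_nonempty with he | ⟨y₁, hy₁, hy₁'⟩
  · rw [he]; simp
  obtain ⟨y₀, hy₀, hy₀'⟩ := hy
  simp only [mem_ofPred_eq] at hy₁'
  have hM : 0 < M := hm.trans_le hmM
  have hrl : 0 < r - l := by linarith
  have hml : 0 ≤ m * lam := mul_nonneg hm.le hlam
  have hlmem : l ∈ Icc l r := left_mem_Icc.2 hlr.le
  have hrmem : r ∈ Icc l r := right_mem_Icc.2 hlr.le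
  have hmono : ∀ x ∈ Icc l r, ∀ y ∈ Icc l r, x ≤ y → L x ≤ L y := fun x hx y hy hxy => by
    have := (hL x hx y hy hxy).1
    have h0 : 0 ≤ m * lam * (y - x) := mul_nonneg hml (by linarith)
    linarith
  set D := max |L l| |L r| with hD
  have hLD : ∀ x ∈ Icc l r, |L x| ≤ D := fun x hx => by
    have h1 := hmono l hlmem x hx hx.1
    have h2 := hmono x hx r hrmem hx.2
    rw [abs_le]
    have h3 := neg_abs_le (L l)
    have h4 := le_abs_self (L r)
    have h5 := le_max_left |L l| |L r|
    have h6 := le_max_right |L l| |L r|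
    constructor <;> linarith
  have hD0 : 0 ≤ D := (abs_nonneg _).trans (hLD l hlmem)
  have hdiff : S / 2 ≤ M * D * (r - l) := by
    have h1 : S / 2 ≤ |F y₀ - F y₁| := by
      have := abs_sub_abs_le_abs_sub (F y₀) (F y₁)
      nlinarith
    have h2 : ‖F y₀ - F y₁‖ ≤ M * D * ‖y₀ - y₁‖ := by
      refine (convex_Icc l r).norm_image_sub_le_of_norm_hasDerivWithin_le
        (fun x hx => (hF x hx).hasDerivWithinAt) (fun x hx => ?_) hy₁ hy₀
      rw [norm_mul, Real.norm_eq_abs, Real.norm_eq_abs, abs_of_pos (hm.trans_le (hw x hx).1)]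
      exact mul_le_mul (hw x hx).2 (hLD x hx) (abs_nonneg _) hM.le
    have h3 : ‖y₀ - y₁‖ ≤ r - l := by
      rw [Real.norm_eq_abs, abs_le]
      constructor <;> linarith [hy₀.1, hy₀.2, hy₁.1, hy₁.2]
    exact h1.trans (h2.trans (mul_le_mul_of_nonneg_left h3 (by positivity)))
  have hD' : 0 < D := by
    rcases hD0.eq_or_lt with h | h
    · rw [← h] at hdiff; simp at hdiff; linarith
    · exact h
  set θ := √κ with hθ
  have hθ0 : 0 < θ := Real.sqrt_pos.2 hκ
  have hθκ : θ * θ = κ := Real.mul_self_sqrt hκ.le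
  have hθ2 : θ ≤ 1 / 2 := by nlinarith
  have hslope : 0 < m * (θ * D) := by positivity
  have hmid : volume (Icc l r ∩ {x | |L x| < θ * D}) ≤
      ENNReal.ofReal (4 * (M / m) * θ * (r - l)) := by
    refine volume_sublevel_le_of_slope_mem hlr hm hmM hlam hL hθ0 hθ2 hD' ?_
    rcases le_total |L l| |L r| with h | h
    · exact ⟨r, hrmem, by rw [hD, max_eq_right h]⟩
    · exact ⟨l, hlmem, by rw [hD, max_eq_left h]⟩
  have hbound : 2 * (κ * S) / (m * (θ * D)) ≤ 4 * (M / m) * θ * (r - l) := by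
    rw [div_le_iff₀ hslope]
    have : 4 * (M / m) * θ * (r - l) * (m * (θ * D)) = 4 * κ * (M * D * (r - l)) := by
      rw [← hθκ]; field_simp
    rw [this]
    nlinarith
  have hpos : volume ((Icc l r ∩ {x | θ * D ≤ L x}) ∩ {x | |F x| < κ * S}) ≤
      ENNReal.ofReal (4 * (M / m) * θ * (r - l)) := by
    refine (volume_sublevel_le_of_slope_ge hslope ?_).trans (ENNReal.ofReal_le_ofReal hbound)
    rintro x ⟨hx, hx'⟩ y ⟨hy, hy'⟩ hxy
    refine le_trans ?_ (le_abs_self _)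
    have hsub : Icc x y ⊆ Icc l r := Icc_subset_Icc hx.1 hy.2
    refine (convex_Icc x y).mul_sub_le_image_sub_of_le_deriv
      (fun z hz => (hF z (hsub hz)).continuousAt.continuousWithinAt)
      (fun z hz => (hF z (hsub (interior_subset hz))).differentiableAt.differentiableWithinAt)
      (fun z hz => ?_) x (left_mem_Icc.2 hxy) y (right_mem_Icc.2 hxy) hxy
    have hz' := interior_subset hz
    rw [(hF z (hsub hz')).deriv]
    have h1 := hmono x hx z (hsub hz') hz'.1
    simp only [mem_ofPred_eq] at hx'
    exact mul_le_mul (hw z (hsub hz')).1 (by linarith) (by positivity)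
      (hm.le.trans (hw z (hsub hz')).1)
  have hneg : volume ((Icc l r ∩ {x | L x ≤ -(θ * D)}) ∩ {x | |F x| < κ * S}) ≤
      ENNReal.ofReal (4 * (M / m) * θ * (r - l)) := by
    refine (volume_sublevel_le_of_slope_ge hslope ?_).trans (ENNReal.ofReal_le_ofReal hbound)
    rintro x ⟨hx, hx'⟩ y ⟨hy, hy'⟩ hxy
    refine le_trans ?_ (neg_le_abs _)
    have hsub : Icc x y ⊆ Icc l r := Icc_subset_Icc hx.1 hy.2
    have := (convex_Icc x y).image_sub_le_mul_sub_of_deriv_le (f := F) (C := -(m * (θ * D)))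
      (fun z hz => (hF z (hsub hz)).continuousAt.continuousWithinAt)
      (fun z hz => (hF z (hsub (interior_subset hz))).differentiableAt.differentiableWithinAt)
      (fun z hz => ?_) x (left_mem_Icc.2 hxy) y (right_mem_Icc.2 hxy) hxy
    · linarith
    have hz' := interior_subset hz
    rw [(hF z (hsub hz')).deriv]
    have h1 := hmono z (hsub hz') y hy hz'.2
    simp only [mem_ofPred_eq] at hy'
    have := mul_le_mul (hw z (hsub hz')).1 (show θ * D ≤ -L z by linarith) (by positivity)
      (hm.le.trans (hw z (hsub hz')).1)
    linarith
  have hcover : Icc l r ∩ {x | |F x| < κ * S} ⊆ (Icc l r ∩ {x | |L x| < θ * D}) ∪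
      (((Icc l r ∩ {x | θ * D ≤ L x}) ∩ {x | |F x| < κ * S}) ∪
        ((Icc l r ∩ {x | L x ≤ -(θ * D)}) ∩ {x | |F x| < κ * S})) := by
    rintro x ⟨hx, hx'⟩
    rcases lt_or_ge |L x| (θ * D) with h | h
    · exact Or.inl ⟨hx, h⟩
    · rcases le_abs.1 h with h | h
      · exact Or.inr (Or.inl ⟨⟨hx, h⟩, hx'⟩)
      · exact Or.inr (Or.inr ⟨⟨hx, by simp only [mem_ofPred_eq]; linarith⟩, hx'⟩)
  have h0 : 0 ≤ 4 * (M / m) * θ * (r - l) := by positivity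
  calc _ ≤ _ := measure_mono hcover
    _ ≤ _ := measure_union_le _ _
    _ ≤ _ := add_le_add le_rfl (measure_union_le _ _)
    _ ≤ _ := add_le_add hmid (add_le_add hpos hneg)
    _ = _ := by
      rw [← ENNReal.ofReal_add h0 h0, ← ENNReal.ofReal_add h0 (by linarith)]
      congr 1; ring

end Sublevel

section Nondivergence

open Set Matrix

/-- A covering bound which passes to halves of intervals, down to some positive scale, holds. -/
theorem volume_le_of_halving {bad : Set ℝ} {P : ℝ → ℝ → Prop} {ε η : ℝ} (hε : 0 ≤ ε)
    (hη : 0 < η)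
    (h_small : ∀ a b, a < b → P a b → b - a < η →
      volume (bad ∩ Icc a b) ≤ ENNReal.ofReal (ε * (b - a)))
    (h_half : ∀ a b l r, a < b → P a b → a ≤ l → r ≤ b → r - l = (b - a) / 2 →
      P l r ∨ volume (bad ∩ Icc l r) ≤ ENNReal.ofReal (ε * (r - l)))
    {a b : ℝ} (hab : a < b) (hP : P a b) :
    volume (bad ∩ Icc a b) ≤ ENNReal.ofReal (ε * (b - a)) := by
  have key : ∀ n : ℕ, ∀ a b, a < b → P a b → b - a < η * 2 ^ n →
      volume (bad ∩ Icc a b) ≤ ENNReal.ofReal (ε * (b - a)) := by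
    intro n
    induction n with
    | zero => intro a b hab hP h; exact h_small a b hab hP (by simpa using h)
    | succ n ih =>
      intro a b hab hP h
      rw [pow_succ] at h
      have h1 : volume (bad ∩ Icc a ((a + b) / 2)) ≤
          ENNReal.ofReal (ε * ((a + b) / 2 - a)) := by
        rcases h_half a b a ((a + b) / 2) hab hP le_rfl (by linarith) (by ring) with h' | h'
        · exact ih _ _ (by linarith) h' (by linarith)
        · exact h'
      have h2 : volume (bad ∩ Icc ((a + b) / 2) b) ≤
          ENNReal.ofReal (ε * (b - (a + b) / 2)) := by
        rcases h_half a b ((a + b) / 2) b hab hP (by linarith) le_rfl (by ring) with h' | h'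
        · exact ih _ _ (by linarith) h' (by linarith)
        · exact h'
      calc volume (bad ∩ Icc a b)
          ≤ volume ((bad ∩ Icc a ((a + b) / 2)) ∪ (bad ∩ Icc ((a + b) / 2) b)) := by
            apply measure_mono
            rintro x ⟨hx, hx'⟩
            rcases le_total x ((a + b) / 2) with h | h
            · exact Or.inl ⟨hx, hx'.1, h⟩
            · exact Or.inr ⟨hx, h, hx'.2⟩
        _ ≤ _ := measure_union_le _ _
        _ ≤ _ := add_le_add h1 h2
        _ = _ := by
          rw [← ENNReal.ofReal_add (mul_nonneg hε (by linarith)) (mul_nonneg hε (by linarith))]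
          congr 1; ring
  obtain ⟨n, hn⟩ := pow_unbounded_of_one_lt ((b - a) / η) (one_lt_two : (1 : ℝ) < 2)
  refine key n a b hab hP ?_
  rw [div_lt_iff₀ hη] at hn
  linarith

/-- An integer vector with coprime coordinates. -/
def IsPrimitiveVec (v : Fin 3 → ℤ) : Prop := ∃ r : Fin 3 → ℤ, r ⬝ᵥ v = 1

theorem exists_eq_smul_isPrimitiveVec {u : Fin 3 → ℤ} (hu : u ≠ 0) :
    ∃ (d : ℤ) (v : Fin 3 → ℤ), d ≠ 0 ∧ u = d • v ∧ IsPrimitiveVec v := by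
  obtain ⟨d, hd⟩ := IsPrincipalIdealRing.principal (Ideal.span (range u))
  have hd' : Ideal.span (range u) = Ideal.span {d} := hd
  have hdvd : ∀ i, d ∣ u i := fun i => by
    rw [← Ideal.mem_span_singleton, ← hd']
    exact Ideal.subset_span ⟨i, rfl⟩
  choose v hv using hdvd
  have hd0 : d ≠ 0 := by
    rintro rfl
    apply hu
    funext i
    simp [hv i]
  have hmem : d ∈ Ideal.span (range u) := by
    rw [hd']; exact Ideal.mem_span_singleton_self d
  obtain ⟨r, hr⟩ := (Ideal.mem_span_range_iff_exists_fun).1 hmem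
  refine ⟨d, v, hd0, by funext i; simp [hv i], r, ?_⟩
  apply mul_left_cancel₀ hd0
  rw [mul_one, dotProduct, Finset.mul_sum]
  conv_rhs => rw [← hr]
  refine Finset.sum_congr rfl fun i _ => ?_
  rw [hv i]; ring

theorem IsPrimitiveVec.ne_zero {v : Fin 3 → ℤ} (hv : IsPrimitiveVec v) : v ≠ 0 := by
  rintro rfl
  obtain ⟨r, hr⟩ := hv
  simp at hr

theorem IsPrimitiveVec.exists_eq_smul {v z : Fin 3 → ℤ} (hv : IsPrimitiveVec v)
    (h : v ⨯₃ z = 0) : ∃ m : ℤ, z = m • v := by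
  obtain ⟨r, hr⟩ := hv
  refine ⟨r ⬝ᵥ z, ?_⟩
  rw [cross_apply] at h
  have h0 := congrFun h 0
  have h1 := congrFun h 1
  have h2 := congrFun h 2
  simp at h0 h1 h2
  rw [vec3_dotProduct] at hr ⊢
  funext i
  fin_cases i <;> simp
  · linear_combination (-z 0) * hr + r 2 * h1 - r 1 * h2
  · linear_combination (-z 1) * hr + r 0 * h2 - r 2 * h0
  · linear_combination (-z 2) * hr + r 1 * h0 - r 0 * h1

theorem cross_cross_eq_zero_of_dotProduct_eq_zero {v u w : Fin 3 → ℤ} (hu : u ⬝ᵥ v = 0)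
    (hw : w ⬝ᵥ v = 0) : v ⨯₃ (u ⨯₃ w) = 0 := by
  rw [cross_cross_eq_smul_sub_smul', dotProduct_comm v w, hu, hw, zero_smul, zero_smul, sub_zero]

/-- The two families of norms, of a varying lattice of rank three and of its dual, which enter the
quantitative nondivergence estimate `DualNormPair.volume_bad_le`. -/
structure DualNormPair (N N' : (Fin 3 → ℤ) → ℝ → ℝ) (α β κ G : ℝ) : Prop where
  nonneg : ∀ u x, 0 ≤ N u x
  le_smul : ∀ (m : ℤ) u x, m ≠ 0 → N u x ≤ N (m • u) x
  cross : ∀ u w x, N' (u ⨯₃ w) x ≤ 2 * (N u x * N w x)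
  sublevel : ∀ u l r, α ≤ l → r ≤ β → l < r → (∃ y ∈ Icc l r, 1 / 2 ≤ N u y) →
    volume (Icc l r ∩ {y | N u y < κ}) ≤ ENNReal.ofReal (G * (r - l))
  equicontinuous : ∃ η > 0, ∀ u, ∀ x ∈ Icc α β, ∀ y ∈ Icc α β, |x - y| < η →
    N u x < 1 / 4 → N u y < 1 / 2

variable {N N' : (Fin 3 → ℤ) → ℝ → ℝ} {α β κ G : ℝ}

theorem DualNormPair.volume_bad_orthogonal_le (hN : DualNormPair N N' α β κ G)
    (hN' : DualNormPair N' N α β κ G) (hG : 0 ≤ G) (hκ' : κ ≤ 1 / 4)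
    {v : Fin 3 → ℤ} (hv : IsPrimitiveVec v) {a b : ℝ} (ha : α ≤ a) (hb : b ≤ β) (hab : a < b)
    (hsup : ∀ u, u ≠ 0 → ∃ y ∈ Icc a b, 1 / 2 ≤ N u y) :
    volume ({y | κ ≤ N' v y ∧ ∃ w, w ≠ 0 ∧ w ⬝ᵥ v = 0 ∧ N w y < κ} ∩ Icc a b) ≤
      ENNReal.ofReal (2 * G * (b - a)) := by
  obtain ⟨η, hη, hcont⟩ := hN.equicontinuous
  refine volume_le_of_halving (P := fun l r => α ≤ l ∧ r ≤ β ∧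
    ∀ u, u ≠ 0 → u ⬝ᵥ v = 0 → ∃ y ∈ Icc l r, 1 / 2 ≤ N u y) (by linarith) hη ?_ ?_ hab
    ⟨ha, hb, fun u hu _ => hsup u hu⟩
  · rintro l r hlr ⟨hl, hr, hP⟩ hη'
    suffices h : {y | κ ≤ N' v y ∧ ∃ w, w ≠ 0 ∧ w ⬝ᵥ v = 0 ∧ N w y < κ} ∩ Icc l r = ∅ by
      rw [h]; simp
    rw [eq_empty_iff_forall_notMem]
    rintro y ⟨⟨-, w, hw0, hwv, hw⟩, hy⟩
    obtain ⟨z, hz, hz'⟩ := hP w hw0 hwv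
    have := hcont w y (Icc_subset_Icc hl hr hy) z (Icc_subset_Icc hl hr hz)
      (by rw [abs_lt]; constructor <;> linarith [hy.1, hy.2, hz.1, hz.2]) (by linarith)
    linarith
  · rintro l₀ r₀ l r hlr₀ ⟨hl₀, hr₀, hP⟩ hl hr hhalf
    by_cases hP' : ∀ u, u ≠ 0 → u ⬝ᵥ v = 0 → ∃ y ∈ Icc l r, 1 / 2 ≤ N u y
    · exact Or.inl ⟨hl₀.trans hl, hr.trans hr₀, hP'⟩
    right
    push Not at hP'
    obtain ⟨u', hu'0, hu'v, hu'⟩ := hP'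
    obtain ⟨d, u, hd, rfl, hu⟩ := exists_eq_smul_isPrimitiveVec hu'0
    have huv : u ⬝ᵥ v = 0 := by
      rw [smul_dotProduct, smul_eq_mul] at hu'v
      exact (mul_eq_zero.1 hu'v).resolve_left hd
    have hul : ∀ y ∈ Icc l r, N u y < 1 / 2 := fun y hy =>
      (hN.le_smul d u y hd).trans_lt (hu' y hy)
    have h1 := hN.sublevel u l₀ r₀ hl₀ hr₀ hlr₀ (hP u hu.ne_zero huv)
    rw [show 2 * G * (r - l) = G * (r₀ - l₀) by rw [hhalf]; ring]
    refine (measure_mono ?_).trans h1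
    rintro y ⟨⟨hy, w, hw0, hwv, hw⟩, hylr⟩
    refine ⟨⟨hl.trans hylr.1, hylr.2.trans hr⟩, ?_⟩
    by_contra hcon
    simp only [mem_ofPred_eq, not_lt] at hcon
    by_cases hcross : u ⨯₃ w = 0
    · obtain ⟨m, rfl⟩ := hu.exists_eq_smul hcross
      have hm : m ≠ 0 := by rintro rfl; simp at hw0
      linarith [hN.le_smul m u y hm]
    · obtain ⟨m, hm⟩ := hv.exists_eq_smul (cross_cross_eq_zero_of_dotProduct_eq_zero huv hwv)
      have hm0 : m ≠ 0 := by rintro rfl; simp [hm] at hcross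
      have h2 := hN'.le_smul m v y hm0
      rw [← hm] at h2
      have h3 := hN.cross u w y
      have h4 := hul y hylr
      have h5 := hN.nonneg u y
      have h6 := hN.nonneg w y
      nlinarith

/-- Quantitative nondivergence: if no nonzero vector of either lattice stays small on the whole
interval, then the lattice has a short vector only on a small part of the interval. -/
theorem DualNormPair.volume_bad_le (hN : DualNormPair N N' α β κ G)
    (hN' : DualNormPair N' N α β κ G) (hG : 0 ≤ G) (hκ' : κ ≤ 1 / 4)
    (hpair : ∀ u v x, u ⬝ᵥ v ≠ 0 → 1 ≤ 3 * (N u x * N' v x))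
    (hαβ : α < β)
    (hsup : ∀ u, u ≠ 0 → ∃ y ∈ Icc α β, 1 / 2 ≤ N u y)
    (hsup' : ∀ u, u ≠ 0 → ∃ y ∈ Icc α β, 1 / 2 ≤ N' u y) :
    volume ({y | ∃ w, w ≠ 0 ∧ N w y < κ} ∩ Icc α β) ≤ ENNReal.ofReal (6 * G * (β - α)) := by
  obtain ⟨η, hη, hcont⟩ := hN.equicontinuous
  refine volume_le_of_halving (P := fun l r => α ≤ l ∧ r ≤ β ∧
    (∀ u, u ≠ 0 → ∃ y ∈ Icc l r, 1 / 2 ≤ N u y) ∧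
    ∀ u, u ≠ 0 → ∃ y ∈ Icc l r, 1 / 2 ≤ N' u y) (by linarith) hη ?_ ?_ hαβ
    ⟨le_rfl, le_rfl, hsup, hsup'⟩
  · rintro l r hlr ⟨hl, hr, hP, -⟩ hη'
    suffices h : {y | ∃ w, w ≠ 0 ∧ N w y < κ} ∩ Icc l r = ∅ by
      rw [h]; simp
    rw [eq_empty_iff_forall_notMem]
    rintro y ⟨⟨w, hw0, hw⟩, hy⟩
    obtain ⟨z, hz, hz'⟩ := hP w hw0
    have := hcont w y (Icc_subset_Icc hl hr hy) z (Icc_subset_Icc hl hr hz)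
      (by rw [abs_lt]; constructor <;> linarith [hy.1, hy.2, hz.1, hz.2]) (by linarith)
    linarith
  · rintro l₀ r₀ l r hlr₀ ⟨hl₀, hr₀, hP, hP'⟩ hl hr hhalf
    have hsplit : ∀ A B : Set ℝ, volume A ≤ ENNReal.ofReal (G * (r₀ - l₀)) →
        volume B ≤ ENNReal.ofReal (2 * G * (r₀ - l₀)) → ∀ C, C ⊆ A ∪ B →
        volume C ≤ ENNReal.ofReal (6 * G * (r - l)) := fun A B hA hB C hC => by
      have h1 : 0 ≤ G * (r₀ - l₀) := mul_nonneg hG (by linarith)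
      calc volume C ≤ _ := (measure_mono hC).trans (measure_union_le _ _)
        _ ≤ _ := add_le_add hA hB
        _ = _ := by
          rw [← ENNReal.ofReal_add h1 (by linarith), hhalf]
          congr 1; ring
    by_cases h : (∀ u, u ≠ 0 → ∃ y ∈ Icc l r, 1 / 2 ≤ N u y)
    · by_cases h' : (∀ u, u ≠ 0 → ∃ y ∈ Icc l r, 1 / 2 ≤ N' u y)
      · exact Or.inl ⟨hl₀.trans hl, hr.trans hr₀, h, h'⟩
      right
      push Not at h'
      obtain ⟨v', hv'0, hv'⟩ := h'
      obtain ⟨d, v, hd, rfl, hv⟩ := exists_eq_smul_isPrimitiveVec hv'0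
      refine hsplit _ _ (hN'.sublevel v l₀ r₀ hl₀ hr₀ hlr₀ (hP' v hv.ne_zero))
        (hN.volume_bad_orthogonal_le hN' hG hκ' hv hl₀ hr₀ hlr₀ hP) _ ?_
      rintro y ⟨⟨w, hw0, hw⟩, hylr⟩
      have hy₀ : y ∈ Icc l₀ r₀ := ⟨hl.trans hylr.1, hylr.2.trans hr⟩
      rcases lt_or_ge (N' v y) κ with hlt | hge
      · exact Or.inl ⟨hy₀, hlt⟩
      refine Or.inr ⟨⟨hge, w, hw0, ?_, hw⟩, hy₀⟩
      by_contra hwv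
      have h1 := hpair w v y hwv
      have h2 := (hN'.le_smul d v y hd).trans_lt (hv' y hylr)
      have h3 := hN.nonneg w y
      nlinarith
    · right
      push Not at h
      obtain ⟨v', hv'0, hv'⟩ := h
      obtain ⟨d, v, hd, rfl, hv⟩ := exists_eq_smul_isPrimitiveVec hv'0
      refine hsplit _ _ (hN.sublevel v l₀ r₀ hl₀ hr₀ hlr₀ (hP v hv.ne_zero))
        (hN'.volume_bad_orthogonal_le hN hG hκ' hv hl₀ hr₀ hlr₀ hP') _ ?_
      rintro y ⟨⟨w, hw0, hw⟩, hylr⟩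
      have hy₀ : y ∈ Icc l₀ r₀ := ⟨hl.trans hylr.1, hylr.2.trans hr⟩
      rcases lt_or_ge (N v y) κ with hlt | hge
      · exact Or.inl ⟨hy₀, hlt⟩
      have hcross : v ⨯₃ w ≠ 0 := fun hcross => by
        obtain ⟨m, rfl⟩ := hv.exists_eq_smul hcross
        have hm : m ≠ 0 := by rintro rfl; simp at hw0
        linarith [hN.le_smul m v y hm]
      refine Or.inr ⟨⟨hge, v ⨯₃ w, hcross, ?_, ?_⟩, hy₀⟩
      · rw [dotProduct_comm, dot_self_cross]
      · have h2 := (hN.le_smul d v y hd).trans_lt (hv' y hylr)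
        have h3 := hN.cross v w y
        have h4 := hN.nonneg v y
        have h5 := hN.nonneg w y
        nlinarith

end Nondivergence

section PlaneCurveLattice

open Set Matrix

/-- The norm of the integer vector `u = (q, p₁, p₂)` in the lattice attached to the point `x` of the
curve `y = f x`, where `g` is the derivative of `f`. -/
noncomputable def primalNorm (f g : ℝ → ℝ) (Q ψ : ℝ) (u : Fin 3 → ℤ) (x : ℝ) : ℝ :=
  max (|(u 0 : ℝ)| / Q) (max (|(u 0 : ℝ) * x - u 1| * (ψ * Q))
    (|(u 0 : ℝ) * f x - u 2 - g x * (u 0 * x - u 1)| / ψ))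

/-- The norm of the integer vector `v` in the lattice dual to that of `primalNorm`. -/
noncomputable def dualNorm (f g : ℝ → ℝ) (Q ψ : ℝ) (v : Fin 3 → ℤ) (x : ℝ) : ℝ :=
  max (|(v 0 : ℝ) + v 1 * x + v 2 * f x| * Q) (max (|(v 1 : ℝ) + v 2 * g x| / (ψ * Q))
    (|(v 2 : ℝ)| * ψ))

variable {f g h : ℝ → ℝ} {Q ψ : ℝ}

theorem primalNorm_le_iff (hQ : 0 < Q) (hψ : 0 < ψ) {u : Fin 3 → ℤ} {x c : ℝ} :
    primalNorm f g Q ψ u x ≤ c ↔ |(u 0 : ℝ)| ≤ c * Q ∧ |(u 0 : ℝ) * x - u 1| ≤ c / (ψ * Q) ∧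
      |(u 0 : ℝ) * f x - u 2 - g x * (u 0 * x - u 1)| ≤ c * ψ := by
  rw [primalNorm, max_le_iff, max_le_iff, div_le_iff₀ hQ, div_le_iff₀ hψ,
    le_div_iff₀ (mul_pos hψ hQ)]

theorem primalNorm_lt_iff (hQ : 0 < Q) (hψ : 0 < ψ) {u : Fin 3 → ℤ} {x c : ℝ} :
    primalNorm f g Q ψ u x < c ↔ |(u 0 : ℝ)| < c * Q ∧ |(u 0 : ℝ) * x - u 1| < c / (ψ * Q) ∧
      |(u 0 : ℝ) * f x - u 2 - g x * (u 0 * x - u 1)| < c * ψ := by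
  rw [primalNorm, max_lt_iff, max_lt_iff, div_lt_iff₀ hQ, div_lt_iff₀ hψ,
    lt_div_iff₀ (mul_pos hψ hQ)]

theorem dualNorm_le_iff (hQ : 0 < Q) (hψ : 0 < ψ) {v : Fin 3 → ℤ} {x c : ℝ} :
    dualNorm f g Q ψ v x ≤ c ↔ |(v 0 : ℝ) + v 1 * x + v 2 * f x| ≤ c / Q ∧
      |(v 1 : ℝ) + v 2 * g x| ≤ c * (ψ * Q) ∧ |(v 2 : ℝ)| ≤ c / ψ := by
  rw [dualNorm, max_le_iff, max_le_iff, div_le_iff₀ (mul_pos hψ hQ), le_div_iff₀ hQ,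
    le_div_iff₀ hψ]

theorem dualNorm_lt_iff (hQ : 0 < Q) (hψ : 0 < ψ) {v : Fin 3 → ℤ} {x c : ℝ} :
    dualNorm f g Q ψ v x < c ↔ |(v 0 : ℝ) + v 1 * x + v 2 * f x| < c / Q ∧
      |(v 1 : ℝ) + v 2 * g x| < c * (ψ * Q) ∧ |(v 2 : ℝ)| < c / ψ := by
  rw [dualNorm, max_lt_iff, max_lt_iff, div_lt_iff₀ (mul_pos hψ hQ), lt_div_iff₀ hQ,
    lt_div_iff₀ hψ]

theorem primalNorm_nonneg (hQ : 0 < Q) (u : Fin 3 → ℤ) (x : ℝ) :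
    0 ≤ primalNorm f g Q ψ u x :=
  le_max_of_le_left (by positivity)

theorem dualNorm_nonneg (hQ : 0 < Q) (v : Fin 3 → ℤ) (x : ℝ) :
    0 ≤ dualNorm f g Q ψ v x :=
  le_max_of_le_left (by positivity)

theorem abs_le_abs_intCast_mul {m : ℤ} (hm : m ≠ 0) (a : ℝ) : |a| ≤ |(m : ℝ) * a| := by
  rw [abs_mul]
  exact le_mul_of_one_le_left (abs_nonneg a) (by exact_mod_cast Int.one_le_abs hm)

theorem primalNorm_le_smul (hQ : 0 < Q) (hψ : 0 < ψ) (m : ℤ) (u : Fin 3 → ℤ) (x : ℝ)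
    (hm : m ≠ 0) : primalNorm f g Q ψ u x ≤ primalNorm f g Q ψ (m • u) x := by
  have h := (primalNorm_le_iff (f := f) (g := g) hQ hψ (u := m • u) (x := x)).1 le_rfl
  rw [primalNorm_le_iff hQ hψ]
  simp only [Pi.smul_apply, smul_eq_mul, Int.cast_mul] at h ⊢
  refine ⟨(abs_le_abs_intCast_mul hm _).trans h.1,
    (abs_le_abs_intCast_mul hm _).trans (le_trans (le_of_eq ?_) h.2.1),
    (abs_le_abs_intCast_mul hm _).trans (le_trans (le_of_eq ?_) h.2.2)⟩ <;>
  · congr 1; ring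

theorem dualNorm_le_smul (hQ : 0 < Q) (hψ : 0 < ψ) (m : ℤ) (u : Fin 3 → ℤ) (x : ℝ)
    (hm : m ≠ 0) : dualNorm f g Q ψ u x ≤ dualNorm f g Q ψ (m • u) x := by
  have h := (dualNorm_le_iff (f := f) (g := g) hQ hψ (v := m • u) (x := x)).1 le_rfl
  rw [dualNorm_le_iff hQ hψ]
  simp only [Pi.smul_apply, smul_eq_mul, Int.cast_mul] at h ⊢
  refine ⟨(abs_le_abs_intCast_mul hm _).trans (le_trans (le_of_eq ?_) h.1),
    (abs_le_abs_intCast_mul hm _).trans (le_trans (le_of_eq ?_) h.2.1),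
    (abs_le_abs_intCast_mul hm _).trans h.2.2⟩ <;>
  · congr 1; ring

theorem abs_mul_sub_mul_le {a b c d A B C D : ℝ} (ha : |a| ≤ A) (hb : |b| ≤ B) (hc : |c| ≤ C)
    (hd : |d| ≤ D) : |a * b - c * d| ≤ A * B + C * D := by
  refine (abs_sub _ _).trans ?_
  rw [abs_mul, abs_mul]
  exact add_le_add (mul_le_mul ha hb (abs_nonneg _) ((abs_nonneg _).trans ha))
    (mul_le_mul hc hd (abs_nonneg _) ((abs_nonneg _).trans hc))

theorem dualNorm_cross_le (hQ : 0 < Q) (hψ : 0 < ψ) (u w : Fin 3 → ℤ) (x : ℝ) :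
    dualNorm f g Q ψ (u ⨯₃ w) x ≤ 2 * (primalNorm f g Q ψ u x * primalNorm f g Q ψ w x) := by
  obtain ⟨a0, a1, a2⟩ := (primalNorm_le_iff (f := f) (g := g) hQ hψ (u := u) (x := x)).1 le_rfl
  obtain ⟨b0, b1, b2⟩ := (primalNorm_le_iff (f := f) (g := g) hQ hψ (u := w) (x := x)).1 le_rfl
  rw [dualNorm_le_iff hQ hψ, cross_apply]
  simp only [cons_val_zero, cons_val_one, cons_val, Int.cast_sub, Int.cast_mul]
  generalize primalNorm f g Q ψ u x = A at *
  generalize primalNorm f g Q ψ w x = B at *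
  refine ⟨?_, ?_, ?_⟩
  · refine le_trans (le_of_eq ?_) ((abs_mul_sub_mul_le a1 b2 a2 b1).trans (le_of_eq ?_))
    · congr 1; ring
    · field_simp; ring
  · refine le_trans (le_of_eq ?_) ((abs_mul_sub_mul_le a0 b2 a2 b0).trans (le_of_eq ?_))
    · congr 1; ring
    · field_simp; ring
  · refine le_trans (le_of_eq ?_) ((abs_mul_sub_mul_le a0 b1 a1 b0).trans (le_of_eq ?_))
    · rw [← abs_neg]; congr 1; ring
    · field_simp; ring

theorem primalNorm_cross_le (hQ : 0 < Q) (hψ : 0 < ψ) (u w : Fin 3 → ℤ) (x : ℝ) :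
    primalNorm f g Q ψ (u ⨯₃ w) x ≤ 2 * (dualNorm f g Q ψ u x * dualNorm f g Q ψ w x) := by
  obtain ⟨a0, a1, a2⟩ := (dualNorm_le_iff (f := f) (g := g) hQ hψ (v := u) (x := x)).1 le_rfl
  obtain ⟨b0, b1, b2⟩ := (dualNorm_le_iff (f := f) (g := g) hQ hψ (v := w) (x := x)).1 le_rfl
  rw [primalNorm_le_iff hQ hψ, cross_apply]
  simp only [cons_val_zero, cons_val_one, cons_val, Int.cast_sub, Int.cast_mul]
  generalize dualNorm f g Q ψ u x = A at *
  generalize dualNorm f g Q ψ w x = B at *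
  refine ⟨?_, ?_, ?_⟩
  · refine le_trans (le_of_eq ?_) ((abs_mul_sub_mul_le a1 b2 a2 b1).trans (le_of_eq ?_))
    · congr 1; ring
    · field_simp; ring
  · refine le_trans (le_of_eq ?_) ((abs_mul_sub_mul_le a0 b2 a2 b0).trans (le_of_eq ?_))
    · congr 1; ring
    · field_simp; ring
  · refine le_trans (le_of_eq ?_) ((abs_mul_sub_mul_le a0 b1 a1 b0).trans (le_of_eq ?_))
    · rw [← abs_neg]; congr 1; ring
    · field_simp; ring

theorem one_le_primalNorm_mul_dualNorm (hQ : 0 < Q) (hψ : 0 < ψ) (u v : Fin 3 → ℤ) (x : ℝ)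
    (huv : u ⬝ᵥ v ≠ 0) :
    1 ≤ 3 * (primalNorm f g Q ψ u x * dualNorm f g Q ψ v x) := by
  obtain ⟨a0, a1, a2⟩ := (primalNorm_le_iff (f := f) (g := g) hQ hψ (u := u) (x := x)).1 le_rfl
  obtain ⟨b0, b1, b2⟩ := (dualNorm_le_iff (f := f) (g := g) hQ hψ (v := v) (x := x)).1 le_rfl
  have h1 : (1 : ℝ) ≤ |((u ⬝ᵥ v : ℤ) : ℝ)| := by exact_mod_cast Int.one_le_abs huv
  refine h1.trans ?_
  rw [vec3_dotProduct]
  generalize primalNorm f g Q ψ u x = A at *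
  generalize dualNorm f g Q ψ v x = B at *
  have key : ((u 0 * v 0 + u 1 * v 1 + u 2 * v 2 : ℤ) : ℝ) =
      (u 0 * (v 0 + v 1 * x + v 2 * f x) - (u 0 * x - u 1) * (v 1 + v 2 * g x)) -
        (u 0 * f x - u 2 - g x * (u 0 * x - u 1)) * v 2 := by
    push_cast; ring
  rw [key]
  refine (abs_sub _ _).trans ?_
  rw [abs_mul _ (v 2 : ℝ)]
  refine (add_le_add (abs_mul_sub_mul_le a0 b0 a1 b1)
    (mul_le_mul a2 b2 (abs_nonneg _) ((abs_nonneg _).trans a2))).trans (le_of_eq ?_)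
  field_simp; ring

end PlaneCurveLattice

section ConvexArc

open Set Matrix

/-- `f` is twice differentiable on `[α, β]` with derivatives `g` and `h`, with `h` between the
positive constants `m ≤ 1` and `M ≥ 1`, and with `|g| ≤ M`. -/
structure IsConvexArc (f g h : ℝ → ℝ) (α β m M : ℝ) : Prop where
  pos : 0 < m
  le_one : m ≤ 1
  one_le : 1 ≤ M
  hasDerivAt : ∀ x ∈ Icc α β, HasDerivAt f (g x) x
  hasDerivAt_deriv : ∀ x ∈ Icc α β, HasDerivAt g (h x) x
  le_second : ∀ x ∈ Icc α β, m ≤ h x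
  second_le : ∀ x ∈ Icc α β, h x ≤ M
  abs_deriv_le : ∀ x ∈ Icc α β, |g x| ≤ M

namespace IsConvexArc

variable {f g h : ℝ → ℝ} {α β m M : ℝ}

theorem mono (H : IsConvexArc f g h α β m M) {a b : ℝ} (ha : α ≤ a) (hb : b ≤ β) :
    IsConvexArc f g h a b m M where
  pos := H.pos
  le_one := H.le_one
  one_le := H.one_le
  hasDerivAt x hx := H.hasDerivAt x ⟨ha.trans hx.1, hx.2.trans hb⟩
  hasDerivAt_deriv x hx := H.hasDerivAt_deriv x ⟨ha.trans hx.1, hx.2.trans hb⟩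
  le_second x hx := H.le_second x ⟨ha.trans hx.1, hx.2.trans hb⟩
  second_le x hx := H.second_le x ⟨ha.trans hx.1, hx.2.trans hb⟩
  abs_deriv_le x hx := H.abs_deriv_le x ⟨ha.trans hx.1, hx.2.trans hb⟩

theorem deriv_sub_mem (H : IsConvexArc f g h α β m M) {x y : ℝ} (hx : x ∈ Icc α β)
    (hy : y ∈ Icc α β) (hxy : x ≤ y) :
    m * (y - x) ≤ g y - g x ∧ g y - g x ≤ M * (y - x) := by
  rcases hxy.eq_or_lt with rfl | hlt
  · simp
  have hsub : Icc x y ⊆ Icc α β := Icc_subset_Icc hx.1 hy.2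
  obtain ⟨c, hc, hc'⟩ := exists_hasDerivAt_eq_slope g h hlt
    (fun z hz => (H.hasDerivAt_deriv z (hsub hz)).continuousAt.continuousWithinAt)
    (fun z hz => H.hasDerivAt_deriv z (hsub (Ioo_subset_Icc_self hz)))
  have hc2 := hsub (Ioo_subset_Icc_self hc)
  rw [eq_div_iff (by linarith)] at hc'
  rw [← hc']
  exact ⟨mul_le_mul_of_nonneg_right (H.le_second c hc2) (by linarith),
    mul_le_mul_of_nonneg_right (H.second_le c hc2) (by linarith)⟩

theorem abs_deriv_sub_le (H : IsConvexArc f g h α β m M) {x y : ℝ} (hx : x ∈ Icc α β)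
    (hy : y ∈ Icc α β) : |g y - g x| ≤ M * |y - x| := by
  rcases le_total x y with hxy | hxy
  · have := H.deriv_sub_mem hx hy hxy
    have h0 : 0 ≤ m * (y - x) := mul_nonneg H.pos.le (by linarith)
    rw [abs_of_nonneg (by linarith), abs_of_nonneg (by linarith)]
    exact this.2
  · have := H.deriv_sub_mem hy hx hxy
    have h0 : 0 ≤ m * (x - y) := mul_nonneg H.pos.le (by linarith)
    rw [abs_sub_comm, abs_sub_comm y, abs_of_nonneg (by linarith), abs_of_nonneg (by linarith)]
    exact this.2

theorem exists_sub_eq (H : IsConvexArc f g h α β m M) {x y : ℝ} (hx : x ∈ Icc α β)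
    (hy : y ∈ Icc α β) :
    ∃ c ∈ uIcc x y, f y - f x = g c * (y - x) := by
  wlog hxy : x ≤ y generalizing x y
  · obtain ⟨c, hc, hc'⟩ := this hy hx (by linarith)
    exact ⟨c, by rwa [uIcc_comm], by linarith⟩
  rcases hxy.eq_or_lt with rfl | hlt
  · exact ⟨x, by simp, by simp⟩
  have hsub : Icc x y ⊆ Icc α β := Icc_subset_Icc hx.1 hy.2
  obtain ⟨c, hc, hc'⟩ := exists_hasDerivAt_eq_slope f g hlt
    (fun z hz => (H.hasDerivAt z (hsub hz)).continuousAt.continuousWithinAt)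
    (fun z hz => H.hasDerivAt z (hsub (Ioo_subset_Icc_self hz)))
  rw [eq_div_iff (by linarith)] at hc'
  exact ⟨c, by rw [uIcc_of_le hxy]; exact Ioo_subset_Icc_self hc, hc'.symm⟩

theorem abs_taylor_le (H : IsConvexArc f g h α β m M) {x y : ℝ} (hx : x ∈ Icc α β)
    (hy : y ∈ Icc α β) : |f y - f x - g x * (y - x)| ≤ M * (y - x) ^ 2 := by
  obtain ⟨c, hc, hc'⟩ := H.exists_sub_eq hx hy
  have hcI : c ∈ Icc α β := uIcc_subset_Icc hx hy hc
  rw [hc', ← sub_mul, abs_mul, ← sq_abs (y - x), sq, ← mul_assoc]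
  refine mul_le_mul_of_nonneg_right ((H.abs_deriv_sub_le hx hcI).trans ?_) (abs_nonneg _)
  exact mul_le_mul_of_nonneg_left (abs_sub_left_of_mem_uIcc hc) (by linarith [H.one_le])

theorem le_taylor (H : IsConvexArc f g h α β m M) {x y : ℝ} (hx : x ∈ Icc α β)
    (hy : y ∈ Icc α β) : m / 2 * (y - x) ^ 2 ≤ f y - f x - g x * (y - x) := by
  have hd : ∀ z ∈ Icc α β, HasDerivAt (fun z => f z - m / 2 * (z - x) ^ 2)
      (g z - m * (z - x)) z := by
    intro z hz
    refine ((H.hasDerivAt z hz).sub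
      ((((hasDerivAt_id' z).sub_const x).pow 2).const_mul (m / 2))).congr_deriv ?_
    norm_num
    ring
  rcases lt_trichotomy x y with hlt | rfl | hlt
  · have hsub : Icc x y ⊆ Icc α β := Icc_subset_Icc hx.1 hy.2
    obtain ⟨c, hc, hc'⟩ := exists_hasDerivAt_eq_slope _ _ hlt
      (fun z hz => (hd z (hsub hz)).continuousAt.continuousWithinAt)
      (fun z hz => hd z (hsub (Ioo_subset_Icc_self hz)))
    rw [eq_div_iff (by linarith)] at hc'
    have := (H.deriv_sub_mem hx (hsub (Ioo_subset_Icc_self hc)) hc.1.le).1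
    have : g x * (y - x) ≤ (g c - m * (c - x)) * (y - x) :=
      mul_le_mul_of_nonneg_right (by linarith) (by linarith)
    simp at hc'
    linarith
  · simp
  · have hsub : Icc y x ⊆ Icc α β := Icc_subset_Icc hy.1 hx.2
    obtain ⟨c, hc, hc'⟩ := exists_hasDerivAt_eq_slope _ _ hlt
      (fun z hz => (hd z (hsub hz)).continuousAt.continuousWithinAt)
      (fun z hz => hd z (hsub (Ioo_subset_Icc_self hz)))
    rw [eq_div_iff (by linarith)] at hc'
    have := (H.deriv_sub_mem (hsub (Ioo_subset_Icc_self hc)) hx hc.2.le).1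
    have : (g c - m * (c - x)) * (x - y) ≤ g x * (x - y) :=
      mul_le_mul_of_nonneg_right (by linarith) (by linarith)
    simp at hc'
    linarith

end IsConvexArc

end ConvexArc

section Nondegenerate

open Set Matrix

theorem primalNorm_neg (f g : ℝ → ℝ) (Q ψ : ℝ) (u : Fin 3 → ℤ) :
    primalNorm f g Q ψ (-u) = primalNorm f g Q ψ u := by
  funext x
  simp only [primalNorm, Pi.neg_apply, Int.cast_neg, abs_neg]
  rw [← abs_neg (-(u 0 : ℝ) * x - _), ← abs_neg (-(u 0 : ℝ) * f x - _ - _)]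
  ring_nf

theorem dualNorm_neg (f g : ℝ → ℝ) (Q ψ : ℝ) (v : Fin 3 → ℤ) :
    dualNorm f g Q ψ (-v) = dualNorm f g Q ψ v := by
  funext x
  simp only [dualNorm, Pi.neg_apply, Int.cast_neg, abs_neg]
  rw [← abs_neg (-(v 0 : ℝ) + _ + _), ← abs_neg (-(v 1 : ℝ) + _)]
  ring_nf

namespace IsConvexArc

variable {f g h : ℝ → ℝ} {α β m M Q ψ κ : ℝ}

theorem volume_primalNorm_lt_le (H : IsConvexArc f g h α β m M) (hQ : 0 < Q) (hψ : 0 < ψ)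
    (hκ : 0 < κ) (hκ' : κ ≤ 1 / 8) (u : Fin 3 → ℤ) {l r : ℝ} (hl : α ≤ l) (hr : r ≤ β)
    (hlr : l < r) (hy : ∃ y ∈ Icc l r, 1 / 2 ≤ primalNorm f g Q ψ u y) :
    volume (Icc l r ∩ {y | primalNorm f g Q ψ u y < κ}) ≤
      ENNReal.ofReal (12 * (M / m) * √(2 * κ) * (r - l)) := by
  wlog hu : 0 ≤ u 0 generalizing u
  · have := this (-u) (by simpa only [primalNorm_neg] using hy) (by simp; omega)
    simpa only [primalNorm_neg] using this
  have hu' : (0 : ℝ) ≤ u 0 := by exact_mod_cast hu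
  have H' := H.mono hl hr
  have hm := H.pos
  have hmM : m ≤ M := H.le_one.trans H.one_le
  have hM : 0 < M := hm.trans_le hmM
  have hsq : 2 * κ ≤ √(2 * κ) := Real.le_sqrt_of_sq_le (by nlinarith)
  have hL : ∀ x ∈ Icc l r, ∀ y ∈ Icc l r, x ≤ y →
      m * (u 0 : ℝ) * (y - x) ≤ ((u 0 : ℝ) * y - u 1) - ((u 0 : ℝ) * x - u 1) ∧
        ((u 0 : ℝ) * y - u 1) - ((u 0 : ℝ) * x - u 1) ≤ M * (u 0 : ℝ) * (y - x) := by
    intro x _ y _ hxy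
    have h0 : 0 ≤ (u 0 : ℝ) * (y - x) := mul_nonneg hu' (by linarith)
    constructor
    · nlinarith [H.le_one]
    · nlinarith [H.one_le]
  obtain ⟨y, hyI, hy⟩ := hy
  rw [← not_lt, primalNorm_lt_iff hQ hψ, not_and_or, not_and_or, not_lt, not_lt, not_lt] at hy
  have hset : {y | primalNorm f g Q ψ u y < κ} = {y | |(u 0 : ℝ)| < κ * Q ∧
      |(u 0 : ℝ) * y - u 1| < κ / (ψ * Q) ∧
      |(u 0 : ℝ) * f y - u 2 - g y * (u 0 * y - u 1)| < κ * ψ} := by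
    ext z; exact primalNorm_lt_iff hQ hψ
  rw [hset]
  rcases hy with hy | hy | hy
  · have : (Icc l r ∩ {y | |(u 0 : ℝ)| < κ * Q ∧ |(u 0 : ℝ) * y - u 1| < κ / (ψ * Q) ∧
        |(u 0 : ℝ) * f y - u 2 - g y * (u 0 * y - u 1)| < κ * ψ}) = ∅ := by
      rw [eq_empty_iff_forall_notMem]
      rintro z ⟨-, hz, -⟩
      nlinarith
    rw [this, measure_empty]
    exact zero_le
  · refine le_trans (measure_mono (inter_subset_inter_right _ fun z hz => ?_))
      ((volume_sublevel_le_of_slope_mem (κ := 2 * κ) (S := 1 / 2 / (ψ * Q)) hlr hm hmM hu' hL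
        (by linarith) (by linarith) (by positivity) ⟨y, hyI, hy⟩).trans
        (ENNReal.ofReal_le_ofReal ?_))
    · simp only [mem_ofPred_eq] at hz ⊢
      refine hz.2.1.trans_le (le_of_eq ?_)
      field_simp
    · refine mul_le_mul_of_nonneg_right ?_ (by linarith)
      exact mul_le_mul (mul_le_mul_of_nonneg_right (by norm_num) (by positivity)) hsq
        (by positivity) (by positivity)
  · refine le_trans (measure_mono (inter_subset_inter_right _ fun z hz => ?_))
      (volume_sublevel_le_of_hasDerivAt_mul (κ := 2 * κ) (S := 1 / 2 * ψ) (w := h)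
        (F := fun z => -((u 0 : ℝ) * f z - u 2 - g z * (u 0 * z - u 1)))
        hlr hm hmM hu' ?_ (fun z hz => ⟨H'.le_second z hz, H'.second_le z hz⟩) hL
        (by linarith) (by linarith) (by positivity) ⟨y, hyI, by rwa [abs_neg]⟩)
    · simp only [mem_ofPred_eq] at hz ⊢
      rw [abs_neg]
      refine hz.2.2.trans_le (le_of_eq ?_)
      ring
    · intro z hz
      refine ((((H'.hasDerivAt z hz).const_mul (u 0 : ℝ)).sub_const (u 2 : ℝ)).sub
        ((H'.hasDerivAt_deriv z hz).mul
          (((hasDerivAt_id' z).const_mul (u 0 : ℝ)).sub_const (u 1 : ℝ)))).neg.congr_deriv ?_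
      ring

theorem volume_dualNorm_lt_le (H : IsConvexArc f g h α β m M) (hQ : 0 < Q) (hψ : 0 < ψ)
    (hκ : 0 < κ) (hκ' : κ ≤ 1 / 8) (v : Fin 3 → ℤ) {l r : ℝ} (hl : α ≤ l) (hr : r ≤ β)
    (hlr : l < r) (hy : ∃ y ∈ Icc l r, 1 / 2 ≤ dualNorm f g Q ψ v y) :
    volume (Icc l r ∩ {y | dualNorm f g Q ψ v y < κ}) ≤
      ENNReal.ofReal (12 * (M / m) * √(2 * κ) * (r - l)) := by
  wlog hv : 0 ≤ v 2 generalizing v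
  · have := this (-v) (by simpa only [dualNorm_neg] using hy) (by simp; omega)
    simpa only [dualNorm_neg] using this
  have hv' : (0 : ℝ) ≤ v 2 := by exact_mod_cast hv
  have H' := H.mono hl hr
  have hm := H.pos
  have hmM : m ≤ M := H.le_one.trans H.one_le
  have hM : 0 < M := hm.trans_le hmM
  have hsq : 2 * κ ≤ √(2 * κ) := Real.le_sqrt_of_sq_le (by nlinarith)
  have hL : ∀ x ∈ Icc l r, ∀ y ∈ Icc l r, x ≤ y →
      m * (v 2 : ℝ) * (y - x) ≤ ((v 1 : ℝ) + v 2 * g y) - ((v 1 : ℝ) + v 2 * g x) ∧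
        ((v 1 : ℝ) + v 2 * g y) - ((v 1 : ℝ) + v 2 * g x) ≤ M * (v 2 : ℝ) * (y - x) := by
    intro x hx y hy hxy
    have h0 := H'.deriv_sub_mem hx hy hxy
    constructor
    · nlinarith [mul_le_mul_of_nonneg_left h0.1 hv']
    · nlinarith [mul_le_mul_of_nonneg_left h0.2 hv']
  obtain ⟨y, hyI, hy⟩ := hy
  rw [← not_lt, dualNorm_lt_iff hQ hψ, not_and_or, not_and_or, not_lt, not_lt, not_lt] at hy
  have hset : {y | dualNorm f g Q ψ v y < κ} = {x | |(v 0 : ℝ) + v 1 * x + v 2 * f x| < κ / Q ∧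
      |(v 1 : ℝ) + v 2 * g x| < κ * (ψ * Q) ∧ |(v 2 : ℝ)| < κ / ψ} := by
    ext z; exact dualNorm_lt_iff hQ hψ
  rw [hset]
  rcases hy with hy | hy | hy
  · refine le_trans (measure_mono (inter_subset_inter_right _ fun z hz => ?_))
      (volume_sublevel_le_of_hasDerivAt_mul (κ := 2 * κ) (S := 1 / 2 / Q) (w := fun _ => 1)
        (F := fun z => (v 0 : ℝ) + v 1 * z + v 2 * f z)
        hlr hm hmM hv' ?_ (fun z hz => ⟨H.le_one, H.one_le⟩) hL
        (by linarith) (by linarith) (by positivity) ⟨y, hyI, hy⟩)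
    · simp only [mem_ofPred_eq] at hz ⊢
      refine hz.1.trans_le (le_of_eq ?_)
      ring
    · intro z hz
      refine ((((hasDerivAt_id' z).const_mul (v 1 : ℝ)).const_add (v 0 : ℝ)).add
        ((H'.hasDerivAt z hz).const_mul (v 2 : ℝ))).congr_deriv ?_
      ring
  · refine le_trans (measure_mono (inter_subset_inter_right _ fun z hz => ?_))
      ((volume_sublevel_le_of_slope_mem (κ := 2 * κ) (S := 1 / 2 * (ψ * Q)) hlr hm hmM hv' hL
        (by linarith) (by linarith) (by positivity) ⟨y, hyI, hy⟩).trans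
        (ENNReal.ofReal_le_ofReal ?_))
    · simp only [mem_ofPred_eq] at hz ⊢
      refine hz.2.1.trans_le (le_of_eq ?_)
      ring
    · refine mul_le_mul_of_nonneg_right ?_ (by linarith)
      exact mul_le_mul (mul_le_mul_of_nonneg_right (by norm_num) (by positivity)) hsq
        (by positivity) (by positivity)
  · have : (Icc l r ∩ {x | |(v 0 : ℝ) + v 1 * x + v 2 * f x| < κ / Q ∧
      |(v 1 : ℝ) + v 2 * g x| < κ * (ψ * Q) ∧ |(v 2 : ℝ)| < κ / ψ}) = ∅ := by
      rw [eq_empty_iff_forall_notMem]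
      rintro z ⟨-, -, -, hz⟩
      have : κ / ψ ≤ 1 / 2 / ψ := by gcongr; linarith
      linarith
    rw [this, measure_empty]
    exact zero_le

theorem exists_primalNorm_lt_of_abs_sub_lt (H : IsConvexArc f g h α β m M) (hQ : 0 < Q)
    (hψ : 0 < ψ) : ∃ η > 0, ∀ u : Fin 3 → ℤ, ∀ x ∈ Icc α β, ∀ y ∈ Icc α β, |x - y| < η →
      primalNorm f g Q ψ u x < 1 / 4 → primalNorm f g Q ψ u y < 1 / 2 := by
  have hM := H.one_le
  set K := M * (1 / 4 / (ψ * Q) + Q / 4 * |β - α|) with hK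
  have hKpos : 0 < K := by positivity
  refine ⟨min (1 / (ψ * Q) / Q) (ψ / 4 / K), by positivity, ?_⟩
  intro u x hx y hy hxy hN
  rw [lt_min_iff, lt_div_iff₀ hQ, lt_div_iff₀ hKpos] at hxy
  rw [primalNorm_lt_iff hQ hψ] at hN ⊢
  obtain ⟨h0, h1, h2⟩ := hN
  have hLz : ∀ z, |(u 0 : ℝ) * z - u 1| ≤ 1 / 4 / (ψ * Q) + Q / 4 * |z - x| := by
    intro z
    have : (u 0 : ℝ) * z - u 1 = (u 0 * x - u 1) + u 0 * (z - x) := by ring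
    rw [this]
    refine (abs_add_le _ _).trans (add_le_add h1.le ?_)
    rw [abs_mul]
    exact mul_le_mul_of_nonneg_right (by linarith) (abs_nonneg _)
  refine ⟨by linarith, ?_, ?_⟩
  · have := hLz y
    rw [abs_sub_comm y x] at this
    have e : 1 / 2 / (ψ * Q) = 1 / 4 / (ψ * Q) + 1 / (ψ * Q) / 4 := by ring
    have : 0 < 1 / (ψ * Q) := by positivity
    linarith
  · have key : ‖(fun z => (u 0 : ℝ) * f z - u 2 - g z * (u 0 * z - u 1)) y -
        (fun z => (u 0 : ℝ) * f z - u 2 - g z * (u 0 * z - u 1)) x‖ ≤ K * ‖y - x‖ := by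
      refine Convex.norm_image_sub_le_of_norm_hasDerivWithin_le
        (f := fun z => (u 0 : ℝ) * f z - u 2 - g z * (u 0 * z - u 1))
        (f' := fun z => -(h z * (u 0 * z - u 1))) (fun z hz => ?_) (fun z hz => ?_)
        (convex_Icc α β) hx hy
      · refine ((((H.hasDerivAt z hz).const_mul (u 0 : ℝ)).sub_const (u 2 : ℝ)).sub
          ((H.hasDerivAt_deriv z hz).mul
            (((hasDerivAt_id' z).const_mul (u 0 : ℝ)).sub_const (u 1 : ℝ)))).hasDerivWithinAt.congr_deriv ?_
        ring
      · rw [norm_neg, Real.norm_eq_abs, abs_mul]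
        have := H.le_second z hz
        refine mul_le_mul ?_ ((hLz z).trans ?_) (abs_nonneg _) (by linarith)
        · rw [abs_of_nonneg (by linarith [H.pos])]
          exact H.second_le z hz
        · have : |z - x| ≤ |β - α| :=
            (abs_sub_le_of_le_of_le hz.1 hz.2 hx.1 hx.2).trans (le_abs_self _)
          gcongr
    simp only [Real.norm_eq_abs] at key
    rw [abs_sub_comm y x] at key
    have := abs_sub_abs_le_abs_sub ((u 0 : ℝ) * f y - u 2 - g y * (u 0 * y - u 1))
      ((u 0 : ℝ) * f x - u 2 - g x * (u 0 * x - u 1))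
    linarith

theorem exists_dualNorm_lt_of_abs_sub_lt (H : IsConvexArc f g h α β m M) (hQ : 0 < Q)
    (hψ : 0 < ψ) : ∃ η > 0, ∀ v : Fin 3 → ℤ, ∀ x ∈ Icc α β, ∀ y ∈ Icc α β, |x - y| < η →
      dualNorm f g Q ψ v x < 1 / 4 → dualNorm f g Q ψ v y < 1 / 2 := by
  have hM := H.one_le
  set K := 1 / 4 * (ψ * Q) + 1 / 4 / ψ * (M * |β - α|) with hK
  have hKpos : 0 < K := by positivity
  have hMpos : 0 < 1 / ψ * M := by positivity
  refine ⟨min (ψ * Q / (1 / ψ * M)) (1 / 4 / Q / K), by positivity, ?_⟩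
  intro v x hx y hy hxy hN
  rw [lt_min_iff, lt_div_iff₀ hMpos, lt_div_iff₀ hKpos] at hxy
  rw [dualNorm_lt_iff hQ hψ] at hN ⊢
  obtain ⟨h0, h1, h2⟩ := hN
  have hBz : ∀ z ∈ Icc α β, |(v 1 : ℝ) + v 2 * g z| ≤
      1 / 4 * (ψ * Q) + 1 / 4 / ψ * (M * |z - x|) := by
    intro z hz
    have : (v 1 : ℝ) + v 2 * g z = (v 1 + v 2 * g x) + v 2 * (g z - g x) := by ring
    rw [this]
    refine (abs_add_le _ _).trans (add_le_add h1.le ?_)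
    rw [abs_mul]
    exact mul_le_mul h2.le (H.abs_deriv_sub_le hx hz) (abs_nonneg _) (by positivity)
  refine ⟨?_, ?_, ?_⟩
  · have key : ‖(fun z => (v 0 : ℝ) + v 1 * z + v 2 * f z) y -
        (fun z => (v 0 : ℝ) + v 1 * z + v 2 * f z) x‖ ≤ K * ‖y - x‖ := by
      refine Convex.norm_image_sub_le_of_norm_hasDerivWithin_le
        (f := fun z => (v 0 : ℝ) + v 1 * z + v 2 * f z) (f' := fun z => v 1 + v 2 * g z) (fun z hz => ?_) (fun z hz => ?_)
        (convex_Icc α β) hx hy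
      · refine ((((hasDerivAt_id' z).const_mul (v 1 : ℝ)).const_add (v 0 : ℝ)).add
          ((H.hasDerivAt z hz).const_mul (v 2 : ℝ))).hasDerivWithinAt.congr_deriv ?_
        ring
      · rw [Real.norm_eq_abs]
        refine (hBz z hz).trans ?_
        have : |z - x| ≤ |β - α| :=
          (abs_sub_le_of_le_of_le hz.1 hz.2 hx.1 hx.2).trans (le_abs_self _)
        rw [hK]
        gcongr
    simp only [Real.norm_eq_abs] at key
    rw [abs_sub_comm y x] at key
    have := abs_sub_abs_le_abs_sub ((v 0 : ℝ) + v 1 * y + v 2 * f y)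
      ((v 0 : ℝ) + v 1 * x + v 2 * f x)
    have e : 1 / 2 / Q = 1 / 4 / Q + 1 / 4 / Q := by ring
    linarith
  · have := hBz y hy
    rw [abs_sub_comm y x] at this
    have e : 1 / 4 / ψ * (M * |x - y|) = 1 / 4 * (|x - y| * (1 / ψ * M)) := by ring
    have : 0 < ψ * Q := by positivity
    linarith
  · have : 1 / 4 / ψ ≤ 1 / 2 / ψ := by gcongr; norm_num
    linarith

end IsConvexArc

end Nondegenerate

section Nondivergence

open Set Matrix

theorem intCast_eq_zero_of_abs_lt_one {n : ℤ} (hn : |(n : ℝ)| < 1) : n = 0 := by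
  rw [← Int.abs_lt_one_iff]; exact_mod_cast hn

namespace IsConvexArc

variable {f g h : ℝ → ℝ} {a b m M Q ψ κ : ℝ}

theorem exists_half_le_primalNorm (hab : a < b) (hψ : 0 < ψ) (hψ' : ψ ≤ 1) (hQ : 1 ≤ Q)
    (hψQ : 1 ≤ ψ * Q) (hψQ' : 1 ≤ ψ * Q * (b - a)) {u : Fin 3 → ℤ} (hu : u ≠ 0) :
    ∃ y ∈ Icc a b, 1 / 2 ≤ primalNorm f g Q ψ u y := by
  by_contra! hcon
  have hQ0 : 0 < Q := by linarith
  have hψQ0 : 0 < ψ * Q := by positivity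
  simp_rw [primalNorm_lt_iff hQ0 hψ] at hcon
  obtain ⟨-, a1, a2⟩ := hcon a (left_mem_Icc.2 hab.le)
  obtain ⟨-, b1, -⟩ := hcon b (right_mem_Icc.2 hab.le)
  rw [lt_div_iff₀ hψQ0] at a1 b1
  have h0 : u 0 = 0 := by
    apply intCast_eq_zero_of_abs_lt_one
    have h1 : |(u 0 : ℝ)| * (b - a) = |((u 0 : ℝ) * b - u 1) - (u 0 * a - u 1)| := by
      rw [← abs_of_pos (sub_pos.2 hab), ← abs_mul]
      ring_nf
    have h2 := abs_sub ((u 0 : ℝ) * b - u 1) (u 0 * a - u 1)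
    have h3 : |(u 0 : ℝ)| * (b - a) * (ψ * Q) < 1 := by
      rw [h1]
      nlinarith
    nlinarith [abs_nonneg (u 0 : ℝ)]
  simp only [h0, Int.cast_zero, zero_mul, zero_sub, abs_neg] at a1 a2
  have h1 : u 1 = 0 := by
    apply intCast_eq_zero_of_abs_lt_one
    nlinarith [abs_nonneg (u 1 : ℝ)]
  simp only [h1, Int.cast_zero, neg_zero, mul_zero, sub_zero, abs_neg] at a2
  have h2 : u 2 = 0 := by
    apply intCast_eq_zero_of_abs_lt_one
    linarith
  exact hu (by funext i; fin_cases i <;> assumption)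

theorem exists_half_le_dualNorm (H : IsConvexArc f g h a b m M) (hab : a < b) (hψ : 0 < ψ)
    (hQ : 1 ≤ Q) (hQ' : 1 ≤ Q * (b - a)) (hQ'' : 8 ≤ Q * (m * (b - a) ^ 2))
    {v : Fin 3 → ℤ} (hv : v ≠ 0) :
    ∃ y ∈ Icc a b, 1 / 2 ≤ dualNorm f g Q ψ v y := by
  by_contra! hcon
  have hQ0 : 0 < Q := by linarith
  simp_rw [dualNorm_lt_iff hQ0 hψ] at hcon
  have hc : (a + b) / 2 ∈ Icc a b := ⟨by linarith, by linarith⟩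
  have ha := left_mem_Icc.2 hab.le
  have hb := right_mem_Icc.2 hab.le
  obtain ⟨a1, -, -⟩ := hcon a ha
  obtain ⟨b1, -, -⟩ := hcon b hb
  obtain ⟨c1, -, -⟩ := hcon _ hc
  rw [lt_div_iff₀ hQ0] at a1 b1 c1
  have h2 : v 2 = 0 := by
    apply intCast_eq_zero_of_abs_lt_one
    have t1 := H.le_taylor hc ha
    have t2 := H.le_taylor hc hb
    set D := f a + f b - 2 * f ((a + b) / 2) with hD
    have hD' : m / 4 * (b - a) ^ 2 ≤ D := by
      have e1 : a - (a + b) / 2 = -((b - a) / 2) := by ring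
      have e2 : b - (a + b) / 2 = (b - a) / 2 := by ring
      rw [e1] at t1
      rw [e2] at t2
      linarith
    have hDpos : 0 < D := lt_of_lt_of_le (by have := H.pos; have := sub_pos.2 hab; positivity) hD'
    have h1 : |(v 2 : ℝ)| * D = |((v 0 : ℝ) + v 1 * a + v 2 * f a) +
        ((v 0 : ℝ) + v 1 * b + v 2 * f b) -
        2 * ((v 0 : ℝ) + v 1 * ((a + b) / 2) + v 2 * f ((a + b) / 2))| := by
      rw [← abs_of_pos hDpos, ← abs_mul, hD]
      ring_nf
    have h3 := (abs_sub (((v 0 : ℝ) + v 1 * a + v 2 * f a) + ((v 0 : ℝ) + v 1 * b + v 2 * f b))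
      (2 * ((v 0 : ℝ) + v 1 * ((a + b) / 2) + v 2 * f ((a + b) / 2)))).trans
      (add_le_add (abs_add_le _ _) (abs_mul _ _).le)
    rw [← h1, abs_two] at h3
    have h4 : |(v 2 : ℝ)| * D * Q < 2 := by nlinarith
    have h5 : 2 ≤ D * Q := by nlinarith
    nlinarith [abs_nonneg (v 2 : ℝ)]
  simp only [h2, Int.cast_zero, zero_mul, add_zero] at a1 b1
  have h1 : v 1 = 0 := by
    apply intCast_eq_zero_of_abs_lt_one
    have h1 : |(v 1 : ℝ)| * (b - a) = |((v 0 : ℝ) + v 1 * b) - (v 0 + v 1 * a)| := by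
      rw [← abs_of_pos (sub_pos.2 hab), ← abs_mul]
      ring_nf
    have h2 := abs_sub ((v 0 : ℝ) + v 1 * b) (v 0 + v 1 * a)
    have h3 : |(v 1 : ℝ)| * (b - a) * Q < 1 := by
      rw [h1]
      nlinarith
    nlinarith [abs_nonneg (v 1 : ℝ)]
  simp only [h1, Int.cast_zero, zero_mul, add_zero] at a1
  have h0 : v 0 = 0 := by
    apply intCast_eq_zero_of_abs_lt_one
    nlinarith [abs_nonneg (v 0 : ℝ)]
  exact hv (by funext i; fin_cases i <;> assumption)

/-- Off a quarter of the interval `[a, b]`, the lattices attached to the points of a convex arc have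
no vector shorter than a constant which depends only on the bounds on the second derivative. -/
theorem volume_exists_primalNorm_lt_le (H : IsConvexArc f g h a b m M) (hab : a < b)
    (hψ : 0 < ψ) (hψ' : ψ ≤ 1) (hQ : 1 ≤ Q) (hψQ : 1 ≤ ψ * Q) (hψQ' : 1 ≤ ψ * Q * (b - a))
    (hQ' : 1 ≤ Q * (b - a)) (hQ'' : 8 ≤ Q * (m * (b - a) ^ 2))
    (hκ : 0 < κ) (hκ' : κ ≤ 1 / 8) (hκM : 288 * (M / m) * √(2 * κ) ≤ 1) :
    volume ({y | ∃ u, u ≠ 0 ∧ primalNorm f g Q ψ u y < κ} ∩ Icc a b) ≤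
      ENNReal.ofReal ((b - a) / 4) := by
  have hQ0 : 0 < Q := by linarith
  have hm := H.pos
  have hM : 0 < M := by linarith [H.one_le]
  have hG : 0 ≤ 12 * (M / m) * √(2 * κ) := by positivity
  have hN : DualNormPair (primalNorm f g Q ψ) (dualNorm f g Q ψ) a b κ
      (12 * (M / m) * √(2 * κ)) :=
    ⟨primalNorm_nonneg hQ0, primalNorm_le_smul hQ0 hψ, dualNorm_cross_le hQ0 hψ,
      fun u l r hl hr hlr hy => H.volume_primalNorm_lt_le hQ0 hψ hκ hκ' u hl hr hlr hy,
      H.exists_primalNorm_lt_of_abs_sub_lt hQ0 hψ⟩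
  have hN' : DualNormPair (dualNorm f g Q ψ) (primalNorm f g Q ψ) a b κ
      (12 * (M / m) * √(2 * κ)) :=
    ⟨dualNorm_nonneg hQ0, dualNorm_le_smul hQ0 hψ, primalNorm_cross_le hQ0 hψ,
      fun u l r hl hr hlr hy => H.volume_dualNorm_lt_le hQ0 hψ hκ hκ' u hl hr hlr hy,
      H.exists_dualNorm_lt_of_abs_sub_lt hQ0 hψ⟩
  refine (hN.volume_bad_le hN' hG (by linarith) (one_le_primalNorm_mul_dualNorm hQ0 hψ) hab
    (fun u hu => exists_half_le_primalNorm hab hψ hψ' hQ hψQ hψQ' hu)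
    (fun u hu => H.exists_half_le_dualNorm hab hψ hQ hQ' hQ'' hu)).trans
    (ENNReal.ofReal_le_ofReal ?_)
  nlinarith [sub_pos.2 hab]

end IsConvexArc

end Nondivergence

section RationalPoints

open Set

theorem distNearestInt_le (z : ℝ) (n : ℤ) : distNearestInt z ≤ |z - n| := round_le z n

/-- Dirichlet's theorem for two linear forms in the twisted coordinates attached to a line of slope
`c`. -/
theorem exists_int_abs_sub_lt_and_abs_sub_sub_lt (x z c : ℝ) {m n : ℕ} (hm : 0 < m) (hn : 0 < n) :
    ∃ q : ℕ, ∃ p₁ p₂ : ℤ, 0 < q ∧ q ≤ m * n ∧ |q * x - p₁| < 1 / m ∧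
      |q * z - p₂ - c * (q * x - p₁)| < 1 / n := by
  have hm' : (0 : ℝ) < m := by exact_mod_cast hm
  have hn' : (0 : ℝ) < n := by exact_mod_cast hn
  set A : ℕ → ℝ := fun q => q * x with hA
  set B : ℕ → ℝ := fun q => q * z - c * Int.fract (q * x) with hB
  have hbox : ∀ (t : ℝ) (k : ℕ), (0 : ℝ) < k → ⌊Int.fract t * k⌋ ∈ Finset.Ico (0 : ℤ) k := by
    intro t k hk
    rw [Finset.mem_Ico]
    refine ⟨Int.floor_nonneg.2 (mul_nonneg (Int.fract_nonneg _) hk.le), Int.floor_lt.2 ?_⟩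
    have := Int.fract_lt_one t
    push_cast
    nlinarith
  have hclose : ∀ (t t' : ℝ) (k : ℕ), (0 : ℝ) < k → ⌊Int.fract t * k⌋ = ⌊Int.fract t' * k⌋ →
      |Int.fract t - Int.fract t'| < 1 / k := by
    intro t t' k hk h
    have := Int.abs_sub_lt_one_of_floor_eq_floor h
    rwa [← sub_mul, abs_mul, abs_of_pos hk, ← lt_div_iff₀ hk] at this
  obtain ⟨q, hq, q', hq', hne, heq⟩ := Finset.exists_ne_map_eq_of_card_lt_of_maps_to
    (s := Finset.range (m * n + 1)) (t := Finset.Ico (0 : ℤ) m ×ˢ Finset.Ico (0 : ℤ) n)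
    (f := fun q => (⌊Int.fract (A q) * m⌋, ⌊Int.fract (B q) * n⌋))
    (by simp [Finset.card_product])
    (fun q _ => Finset.mem_product.2 ⟨hbox _ _ hm', hbox _ _ hn'⟩)
  wlog hlt : q < q' generalizing q q'
  · exact this q' hq' q hq hne.symm heq.symm (lt_of_le_of_ne (not_lt.1 hlt) hne.symm)
  simp only [Prod.mk.injEq] at heq
  refine ⟨q' - q, ⌊A q'⌋ - ⌊A q⌋, ⌊B q'⌋ - ⌊B q⌋, by omega, ?_, ?_, ?_⟩
  · rw [Finset.mem_range] at hq'
    omega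
  · have := hclose _ _ m hm' heq.1.symm
    refine lt_of_le_of_lt (le_of_eq ?_) this
    rw [Nat.cast_sub hlt.le, Int.fract, Int.fract]
    push_cast
    simp only [hA]
    ring_nf
  · have := hclose _ _ n hn' heq.2.symm
    refine lt_of_le_of_lt (le_of_eq ?_) this
    rw [Nat.cast_sub hlt.le, Int.fract, Int.fract]
    push_cast
    simp only [hA, hB]
    rw [Int.fract, Int.fract]
    ring_nf

namespace IsConvexArc

variable {f g h : ℝ → ℝ} {a b m M Q ψ κ : ℝ}

set_option maxHeartbeats 400000 in
theorem exists_nat_distNearestInt_lt (H : IsConvexArc f g h a b m M) (hψ : 0 < ψ)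
    (hψ' : ψ ≤ 1) (hQ : 1 ≤ Q) (hψQ : 1 ≤ ψ * Q) (hψQ' : ψ ^ 2 * Q ≤ 1)
    (hψM : 64 * M ≤ κ ^ 2 * (ψ * Q) ^ 3) (hκ : 0 < κ) (hκ' : κ ≤ 1 / 8) {x : ℝ}
    (hx : x ∈ Icc a b) (hgood : ∀ u, u ≠ 0 → κ ≤ primalNorm f g Q ψ u x) :
    ∃ q : ℕ, ∃ p : ℝ, κ * Q ≤ q ∧ q ≤ 4 * Q / κ ^ 2 ∧ |x - p| ≤ 1 / (ψ * Q ^ 2) ∧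
      ∀ y ∈ Icc a b, |y - p| ≤ κ ^ 2 / (16 * M) * ψ / Q →
        distNearestInt (q * y) < ψ ∧ distNearestInt (q * f y) < ψ := by
  have hQ0 : 0 < Q := by linarith
  have hM := H.one_le
  have hM0 : 0 < M := by linarith
  have hψQ0 : 0 < ψ * Q := by positivity
  have hA0 : 0 < ψ * Q / κ := by positivity
  have hB0 : 0 < 1 / (κ * ψ) := by positivity
  have hA1 : 1 ≤ ψ * Q / κ := by rw [le_div_iff₀ hκ]; linarith
  have hB1 : 1 ≤ 1 / (κ * ψ) := by rw [le_div_iff₀ (by positivity)]; nlinarith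
  obtain ⟨q, p₁, p₂, hq0, hqle, h1, h2⟩ := exists_int_abs_sub_lt_and_abs_sub_sub_lt x (f x) (g x)
    (Nat.ceil_pos.2 hA0) (Nat.ceil_pos.2 hB0)
  have hm1 := Nat.le_ceil (ψ * Q / κ)
  have hm2 := Nat.le_ceil (1 / (κ * ψ))
  have hm1' : (⌈ψ * Q / κ⌉₊ : ℝ) ≤ 2 * (ψ * Q / κ) := by
    have := Nat.ceil_lt_add_one hA0.le
    linarith
  have hm2' : (⌈1 / (κ * ψ)⌉₊ : ℝ) ≤ 2 * (1 / (κ * ψ)) := by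
    have := Nat.ceil_lt_add_one hB0.le
    linarith
  have h1' : |q * x - p₁| < κ / (ψ * Q) := by
    refine h1.trans_le ?_
    rw [← one_div_div (ψ * Q) κ]
    exact one_div_le_one_div_of_le hA0 hm1
  have h2' : |q * f x - p₂ - g x * (q * x - p₁)| < κ * ψ := by
    refine h2.trans_le ?_
    exact (one_div_le_one_div_of_le hB0 hm2).trans (one_div_one_div _).le
  have hq0' : (0 : ℝ) < q := by exact_mod_cast hq0
  have hqle' : (q : ℝ) ≤ 4 * Q / κ ^ 2 := by
    have h3 : (q : ℝ) ≤ ⌈ψ * Q / κ⌉₊ * ⌈1 / (κ * ψ)⌉₊ := by exact_mod_cast hqle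
    have h4 := mul_le_mul hm1' hm2' (by positivity) (by positivity)
    refine (h3.trans h4).trans (le_of_eq ?_)
    field_simp
    ring
  have hqge : κ * Q ≤ q := by
    have hu : (![(q : ℤ), p₁, p₂] : Fin 3 → ℤ) ≠ 0 := by
      intro h0
      have := congrFun h0 0
      simp at this
      omega
    have := hgood _ hu
    rw [← not_lt, primalNorm_lt_iff hQ0 hψ] at this
    simp only [Matrix.cons_val_zero, Matrix.cons_val_one, Matrix.cons_val, Int.cast_natCast] at this
    by_contra! hcon
    exact this ⟨by rwa [abs_of_pos hq0'], h1', h2'⟩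
  have hxp : |x - p₁ / q| ≤ 1 / (ψ * Q ^ 2) := by
    have e : x - p₁ / q = (q * x - p₁) / q := by field_simp
    rw [e, abs_div, abs_of_pos hq0', div_le_div_iff₀ hq0' (by positivity)]
    rw [lt_div_iff₀ hψQ0] at h1'
    nlinarith
  refine ⟨q, p₁ / q, hqge, hqle', hxp, ?_⟩
  intro y hy hyp
  have hqyp : |q * y - p₁| ≤ ψ / (4 * M) := by
    have e : q * y - p₁ = q * (y - p₁ / q) := by field_simp
    rw [e, abs_mul, abs_of_pos hq0']
    refine (mul_le_mul hqle' hyp (abs_nonneg _) (by positivity)).trans (le_of_eq ?_)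
    field_simp
    norm_num
  have hψ4 : ψ / (4 * M) * M = ψ / 4 := by field_simp
  refine ⟨lt_of_le_of_lt ((distNearestInt_le _ p₁).trans hqyp) ?_,
    lt_of_le_of_lt (distNearestInt_le _ p₂) ?_⟩
  · rw [div_lt_iff₀ (by positivity)]
    nlinarith
  have hrd : κ ^ 2 / (16 * M) * ψ / Q ≤ 1 / (ψ * Q ^ 2) := by
    rw [div_le_div_iff₀ hQ0 (by positivity)]
    have h3 : κ ^ 2 / (16 * M) ≤ 1 := by
      rw [div_le_one (by positivity)]
      nlinarith
    have h4 : κ ^ 2 / (16 * M) * ψ * (ψ * Q ^ 2) = κ ^ 2 / (16 * M) * (ψ ^ 2 * Q) * Q := by ring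
    rw [h4]
    have h5 : 0 ≤ κ ^ 2 / (16 * M) := by positivity
    have h6 : κ ^ 2 / (16 * M) * (ψ ^ 2 * Q) ≤ 1 * 1 :=
      mul_le_mul h3 hψQ' (by positivity) zero_le_one
    nlinarith
  have hyx : |y - x| ≤ 2 * (1 / (ψ * Q ^ 2)) := by
    have e : y - x = (y - p₁ / q) - (x - p₁ / q) := by ring
    rw [e]
    linarith [abs_sub (y - p₁ / q) (x - p₁ / q)]
  have key : q * f y - p₂ = q * (f y - f x - g x * (y - x)) + g x * (q * y - p₁) +
      (q * f x - p₂ - g x * (q * x - p₁)) := by ring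
  have t1 : |q * (f y - f x - g x * (y - x))| ≤ ψ / 4 := by
    rw [abs_mul, abs_of_pos hq0']
    have h3 : (y - x) ^ 2 ≤ (2 * (1 / (ψ * Q ^ 2))) ^ 2 := by
      rw [← sq_abs]
      exact pow_le_pow_left₀ (abs_nonneg _) hyx 2
    have h4 : |f y - f x - g x * (y - x)| ≤ M * (2 * (1 / (ψ * Q ^ 2))) ^ 2 :=
      (H.abs_taylor_le hx hy).trans (mul_le_mul_of_nonneg_left h3 hM0.le)
    refine (mul_le_mul hqle' h4 (abs_nonneg _) (by positivity)).trans ?_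
    have e : 4 * Q / κ ^ 2 * (M * (2 * (1 / (ψ * Q ^ 2))) ^ 2) =
        16 * M / (κ ^ 2 * ψ ^ 2 * Q ^ 3) := by
      field_simp
      norm_num
    rw [e, div_le_iff₀ (by positivity)]
    have : ψ / 4 * (κ ^ 2 * ψ ^ 2 * Q ^ 3) = κ ^ 2 * (ψ * Q) ^ 3 / 4 := by ring
    linarith
  have t2 : |g x * (q * y - p₁)| ≤ ψ / 4 := by
    rw [abs_mul]
    refine (mul_le_mul (H.abs_deriv_le x hx) hqyp (abs_nonneg _) hM0.le).trans (le_of_eq ?_)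
    linarith
  rw [key]
  have t3 := abs_add_three (q * (f y - f x - g x * (y - x))) (g x * (q * y - p₁))
    (q * f x - p₂ - g x * (q * x - p₁))
  have : κ * ψ ≤ 1 / 8 * ψ := mul_le_mul_of_nonneg_right hκ' hψ.le
  linarith

/-- Many cells of length `1 / (ψ * Q ^ 2)` in `[a, b]` contain the abscissa of a rational point of
denominator comparable to `Q` close to the arc. -/
theorem exists_finset_distNearestInt_lt (H : IsConvexArc f g h a b m M) (hab : a < b)
    (hψ : 0 < ψ) (hψ' : ψ ≤ 1) (hQ : 1 ≤ Q) (hψQ : 1 ≤ ψ * Q) (hψQ' : 8 ≤ ψ * Q * (b - a))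
    (hQ'' : 8 ≤ Q * (m * (b - a) ^ 2)) (hψQ2 : ψ ^ 2 * Q ≤ 1)
    (hψM : 64 * M ≤ κ ^ 2 * (ψ * Q) ^ 3)
    (hκ : 0 < κ) (hκ' : κ ≤ 1 / 8) (hκM : 288 * (M / m) * √(2 * κ) ≤ 1) {d r : ℝ}
    (hd : d = 1 / (ψ * Q ^ 2)) (hr : r = κ ^ 2 / (16 * M) * ψ / Q) (hrd : r ≤ d) :
    ∃ (J : Finset ℤ) (p : ℤ → ℝ), (b - a) / 12 ≤ J.card * d ∧ ∀ j ∈ J,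
      p j ∈ Icc (j * d) ((j + 1) * d) ∧ Icc (p j - r) (p j + r) ⊆ Icc a b ∧
      ∃ q : ℕ, κ * Q ≤ q ∧ q ≤ 4 * Q / κ ^ 2 ∧ ∀ y ∈ Icc (p j - r) (p j + r),
        distNearestInt (q * y) < ψ ∧ distNearestInt (q * f y) < ψ := by
  classical
  have hQ0 : 0 < Q := by linarith
  have hd0 : 0 < d := by rw [hd]; positivity
  have hlen := sub_pos.2 hab
  have hψQ1 : ψ * Q ≤ Q := mul_le_of_le_one_left hQ0.le hψ'
  have hd8 : d ≤ (b - a) / 8 := by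
    rw [hd, div_le_iff₀ (by positivity)]
    nlinarith [mul_le_mul_of_nonneg_right hψQ' (show 0 ≤ Q by linarith)]
  have hP : ∀ j : ℤ, ∃ p : ℝ, (∃ p' : ℝ,
      p' ∈ Icc (j * d) ((j + 1) * d) ∧ Icc (p' - r) (p' + r) ⊆ Icc a b ∧
      ∃ q : ℕ, κ * Q ≤ q ∧ q ≤ 4 * Q / κ ^ 2 ∧ ∀ y ∈ Icc (p' - r) (p' + r),
        distNearestInt (q * y) < ψ ∧ distNearestInt (q * f y) < ψ) →
      p ∈ Icc (j * d) ((j + 1) * d) ∧ Icc (p - r) (p + r) ⊆ Icc a b ∧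
      ∃ q : ℕ, κ * Q ≤ q ∧ q ≤ 4 * Q / κ ^ 2 ∧ ∀ y ∈ Icc (p - r) (p + r),
        distNearestInt (q * y) < ψ ∧ distNearestInt (q * f y) < ψ := by
    intro j
    by_cases hj : ∃ p' : ℝ, p' ∈ Icc (j * d) ((j + 1) * d) ∧ Icc (p' - r) (p' + r) ⊆ Icc a b ∧
      ∃ q : ℕ, κ * Q ≤ q ∧ q ≤ 4 * Q / κ ^ 2 ∧ ∀ y ∈ Icc (p' - r) (p' + r),
        distNearestInt (q * y) < ψ ∧ distNearestInt (q * f y) < ψ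
    · obtain ⟨p, hp⟩ := hj
      exact ⟨p, fun _ => hp⟩
    · exact ⟨0, fun h => absurd h hj⟩
  choose p hp using hP
  set E : ℤ → Prop := fun j => ∃ p' : ℝ,
      p' ∈ Icc (j * d) ((j + 1) * d) ∧ Icc (p' - r) (p' + r) ⊆ Icc a b ∧
      ∃ q : ℕ, κ * Q ≤ q ∧ q ≤ 4 * Q / κ ^ 2 ∧ ∀ y ∈ Icc (p' - r) (p' + r),
        distNearestInt (q * y) < ψ ∧ distNearestInt (q * f y) < ψ with hE
  set J := (Finset.Icc ⌊a / d⌋ ⌊b / d⌋).filter E with hJ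
  refine ⟨J, p, ?_, fun j hj => hp j (Finset.mem_filter.1 hj).2⟩
  have hr0 : 0 ≤ r := by
    have := H.one_le
    rw [hr]; positivity
  have hcover : Icc (a + (b - a) / 4) (b - (b - a) / 4) ⊆
      ({y | ∃ u, u ≠ 0 ∧ primalNorm f g Q ψ u y < κ} ∩ Icc a b) ∪
        ⋃ j ∈ J, Icc (((j : ℝ) - 1) * d) ((j + 2) * d) := by
    intro x hx
    have hxab : x ∈ Icc a b := ⟨by linarith [hx.1], by linarith [hx.2]⟩
    by_cases hbad : ∃ u, u ≠ 0 ∧ primalNorm f g Q ψ u x < κ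
    · exact Or.inl ⟨hbad, hxab⟩
    right
    push Not at hbad
    obtain ⟨q, p', hq1, hq2, hxp, hy⟩ := H.exists_nat_distNearestInt_lt hψ hψ' hQ hψQ hψQ2 hψM hκ
      hκ' hxab hbad
    rw [← hd, abs_le] at hxp
    rw [← hr] at hy
    have hsub : Icc (p' - r) (p' + r) ⊆ Icc a b :=
      Icc_subset_Icc (by linarith [hx.1]) (by linarith [hx.2])
    have hj1 := Int.floor_le (p' / d)
    have hj2 := Int.lt_floor_add_one (p' / d)
    rw [le_div_iff₀ hd0] at hj1
    rw [div_lt_iff₀ hd0] at hj2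
    simp only [mem_iUnion]
    refine ⟨⌊p' / d⌋, ?_, by nlinarith, by nlinarith⟩
    refine Finset.mem_filter.2 ⟨Finset.mem_Icc.2 ⟨?_, ?_⟩, p', ⟨hj1, hj2.le⟩, hsub, q, hq1, hq2,
      fun y hy' => hy y (hsub hy') (abs_le.2 ⟨by linarith [hy'.1], by linarith [hy'.2]⟩)⟩
    · exact Int.floor_le_floor (div_le_div_of_nonneg_right (by linarith [hx.1]) hd0.le)
    · exact Int.floor_le_floor (div_le_div_of_nonneg_right (by linarith [hx.2]) hd0.le)
  have hvol := (measure_mono hcover).trans ((measure_union_le _ _).trans (add_le_add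
    (H.volume_exists_primalNorm_lt_le hab hψ hψ' hQ hψQ (by linarith) (by nlinarith) hQ'' hκ hκ'
      hκM)
    (measure_biUnion_finset_le (μ := volume) J fun j => Icc (((j : ℝ) - 1) * d) ((j + 2) * d))))
  have hcell : ∀ j : ℤ, volume (Icc (((j : ℝ) - 1) * d) ((j + 2) * d)) = ENNReal.ofReal (3 * d) :=
    fun j => by rw [Real.volume_Icc]; ring_nf
  simp only [hcell, Finset.sum_const, nsmul_eq_mul, Real.volume_Icc] at hvol
  rw [← ENNReal.ofReal_natCast, ← ENNReal.ofReal_mul (by positivity),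
    ← ENNReal.ofReal_add (by linarith) (by positivity),
    ENNReal.ofReal_le_ofReal_iff (by positivity)] at hvol
  linarith

end IsConvexArc

end RationalPoints

section Block

open Set

theorem rpow_mul_min_le_potential_sub {s ρ r r' : ℝ} (hs : 0 < s) (hs1 : s < 1) (hρ : 0 < ρ)
    (hr' : 0 < r') (hrr : r' ≤ r / 2) {K B : ℝ} (hK : K * (1 - (1 / 2) ^ s) = 1)
    (hB : B * (2 ^ (1 - s) - 1) = 1) (hK0 : 0 < K) (hB0 : 0 < B) {Φ : ℝ → ℝ}
    (hΦ : ∀ x, x ≤ ρ → Φ x = K * x ^ s)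
    (hΦ' : ∀ x, ρ < x → Φ x = (B + K + 1) * ρ ^ s - B * ρ * x ^ (s - 1)) :
    r ^ (s - 1) * min ρ r ≤ Φ r - Φ r' := by
  have hr : 0 < r := by linarith
  have hmul : ∀ x : ℝ, 0 < x → x ^ (s - 1) * x = x ^ s := by
    intro x hx
    nth_rewrite 2 [← Real.rpow_one x]
    rw [← Real.rpow_add hx]
    ring_nf
  rcases le_or_gt r ρ with h | h
  · rw [min_eq_right h, hmul r hr, hΦ r h, hΦ r' (by linarith)]
    have h1 : r' ^ s ≤ (1 / 2) ^ s * r ^ s := by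
      rw [← Real.mul_rpow (by norm_num) hr.le]
      exact Real.rpow_le_rpow hr'.le (by linarith) hs.le
    have h2 := mul_le_mul_of_nonneg_left h1 hK0.le
    have h3 : K * r ^ s - K * ((1 / 2) ^ s * r ^ s) = r ^ s := by linear_combination r ^ s * hK
    linarith
  rw [min_eq_left h.le, hΦ' r h]
  have hrpos : 0 < r ^ (s - 1) := Real.rpow_pos_of_pos hr _
  rcases le_or_gt r' ρ with h' | h'
  · rw [hΦ r' h']
    have h1 : r' ^ s ≤ ρ ^ s := Real.rpow_le_rpow hr'.le h' hs.le
    have h2 : r ^ (s - 1) * ρ ≤ ρ ^ s := by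
      rw [← hmul ρ hρ]
      exact mul_le_mul_of_nonneg_right
        (Real.rpow_le_rpow_of_nonpos hρ h.le (by linarith)) hρ.le
    nlinarith
  · rw [hΦ' r' h']
    have h1 : 2 ^ (1 - s) * r ^ (s - 1) ≤ r' ^ (s - 1) := by
      have e : (2 : ℝ) ^ (1 - s) * r ^ (s - 1) = (r / 2) ^ (s - 1) := by
        rw [Real.div_rpow hr.le (by norm_num), show (1 - s) = -(s - 1) by ring,
          Real.rpow_neg (by norm_num)]
        ring
      rw [e]
      exact Real.rpow_le_rpow_of_nonpos hr' hrr (by linarith)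
    have h2 : B * ρ * (2 ^ (1 - s) * r ^ (s - 1)) ≤ B * ρ * r' ^ (s - 1) :=
      mul_le_mul_of_nonneg_left h1 (by positivity)
    have h3 : B * ρ * (2 ^ (1 - s) * r ^ (s - 1)) - B * ρ * r ^ (s - 1) =
        (B * (2 ^ (1 - s) - 1)) * (r ^ (s - 1) * ρ) := by ring
    rw [hB] at h3
    linarith

theorem exists_sum_rpow_mul_min_le {s : ℝ} (hs : 0 < s) (hs1 : s < 1) :
    ∃ A > 0, ∀ r : ℕ → ℝ, (∀ t, 0 < r t) → (∀ t, r (t + 1) ≤ r t / 2) → ∀ ρ > 0,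
      ∀ F : Finset ℕ, ∑ t ∈ F, r t ^ (s - 1) * min ρ (r t) ≤ A * ρ ^ s := by
  have hk : (1 / 2 : ℝ) ^ s < 1 := Real.rpow_lt_one (by norm_num) (by norm_num) hs
  have hb : (1 : ℝ) < 2 ^ (1 - s) := Real.one_lt_rpow (by norm_num) (by linarith)
  set K : ℝ := 1 / (1 - (1 / 2) ^ s) with hK
  set B : ℝ := 1 / (2 ^ (1 - s) - 1) with hB
  have hK0 : 0 < K := one_div_pos.2 (by linarith)
  have hB0 : 0 < B := one_div_pos.2 (by linarith)
  refine ⟨B + K + 1, by positivity, fun r hr hrr ρ hρ F => ?_⟩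
  set Φ : ℝ → ℝ := fun x =>
    if x ≤ ρ then K * x ^ s else (B + K + 1) * ρ ^ s - B * ρ * x ^ (s - 1) with hΦ
  have hρs : 0 < ρ ^ s := Real.rpow_pos_of_pos hρ _
  have hΦ1 : ∀ x, x ≤ ρ → Φ x = K * x ^ s := fun x hx => by simp only [hΦ]; rw [if_pos hx]
  have hΦ2 : ∀ x, ρ < x → Φ x = (B + K + 1) * ρ ^ s - B * ρ * x ^ (s - 1) :=
    fun x hx => by simp only [hΦ]; rw [if_neg (not_le.2 hx)]
  have hΦ0 : ∀ x, 0 < x → 0 ≤ Φ x := by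
    intro x hx
    rcases le_or_gt x ρ with h | h
    · rw [hΦ1 x h]; positivity
    · rw [hΦ2 x h]
      have h2 : x ^ (s - 1) * ρ ≤ ρ ^ s := by
        have e : ρ ^ (s - 1) * ρ = ρ ^ s := by
          nth_rewrite 2 [← Real.rpow_one ρ]
          rw [← Real.rpow_add hρ]
          ring_nf
        rw [← e]
        exact mul_le_mul_of_nonneg_right
          (Real.rpow_le_rpow_of_nonpos hρ h.le (by linarith)) hρ.le
      nlinarith
  have hΦA : ∀ x, 0 < x → Φ x ≤ (B + K + 1) * ρ ^ s := by
    intro x hx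
    rcases le_or_gt x ρ with h | h
    · rw [hΦ1 x h]
      have : x ^ s ≤ ρ ^ s := Real.rpow_le_rpow hx.le h hs.le
      nlinarith
    · rw [hΦ2 x h]
      have : 0 ≤ B * ρ * x ^ (s - 1) := by positivity
      linarith
  obtain ⟨N, hN⟩ := F.exists_nat_subset_range
  calc ∑ t ∈ F, r t ^ (s - 1) * min ρ (r t)
      ≤ ∑ t ∈ Finset.range N, r t ^ (s - 1) * min ρ (r t) :=
        Finset.sum_le_sum_of_subset_of_nonneg hN fun t _ _ =>
          mul_nonneg (Real.rpow_nonneg (hr t).le _) (le_min hρ.le (hr t).le)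
    _ ≤ ∑ t ∈ Finset.range N, (Φ (r t) - Φ (r (t + 1))) :=
        Finset.sum_le_sum fun t _ => rpow_mul_min_le_potential_sub hs hs1 hρ (hr _) (hrr t)
          (one_div_mul_cancel (by linarith)) (one_div_mul_cancel (by linarith)) hK0 hB0 hΦ1 hΦ2
    _ = Φ (r 0) - Φ (r N) := Finset.sum_range_sub' _ N
    _ ≤ (B + K + 1) * ρ ^ s := by linarith [hΦA _ (hr 0), hΦ0 _ (hr N)]

theorem sum_volume_inter_le {d r u v : ℝ} (hd : 0 < d) (hr : 0 ≤ r) (hrd : r ≤ d) (huv : u ≤ v)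
    {J : Finset ℤ} {p : ℤ → ℝ} (hp : ∀ j ∈ J, p j ∈ Icc (j * d) ((j + 1) * d)) :
    ∑ j ∈ J, volume (Icc u v ∩ Icc (p j - r) (p j + r)) ≤
      ENNReal.ofReal (((v - u) / d + 4) * min (v - u) (2 * r)) := by
  classical
  set A : ℝ := (u - r) / d - 1 with hA
  set B : ℝ := (v + r) / d with hB
  have hAB : A ≤ B := by
    have : (u - r) / d ≤ (v + r) / d := div_le_div_of_nonneg_right (by linarith) hd.le
    linarith
  have hmin : 0 ≤ min (v - u) (2 * r) := le_min (by linarith) (by linarith)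
  have h1 : ∀ j ∈ J, volume (Icc u v ∩ Icc (p j - r) (p j + r)) ≤
      if j ∈ Finset.Icc ⌈A⌉ ⌊B⌋ then ENNReal.ofReal (min (v - u) (2 * r)) else 0 := by
    intro j hj
    obtain ⟨hj1, hj2⟩ := hp j hj
    split_ifs with hmem
    · rw [ENNReal.ofReal_min]
      refine le_min ((measure_mono inter_subset_left).trans (by rw [Real.volume_Icc]))
        ((measure_mono inter_subset_right).trans (le_of_eq ?_))
      rw [Real.volume_Icc]
      ring_nf
    · have : Icc u v ∩ Icc (p j - r) (p j + r) = ∅ := by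
        rw [eq_empty_iff_forall_notMem]
        rintro y ⟨hy1, hy2⟩
        apply hmem
        rw [Finset.mem_Icc, Int.ceil_le, Int.le_floor, hA, hB, le_div_iff₀ hd, sub_le_iff_le_add,
          div_le_iff₀ hd]
        exact ⟨by linarith [hy1.1, hy2.2], by linarith [hy1.2, hy2.1]⟩
      rw [this, measure_empty]
  refine (Finset.sum_le_sum h1).trans ?_
  rw [← Finset.sum_filter, Finset.sum_const, nsmul_eq_mul, ← ENNReal.ofReal_natCast,
    ← ENNReal.ofReal_mul (by positivity)]
  refine ENNReal.ofReal_le_ofReal (mul_le_mul_of_nonneg_right ?_ hmin)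
  have h2 : ((J.filter fun j => j ∈ Finset.Icc ⌈A⌉ ⌊B⌋).card : ℝ) ≤ (Finset.Icc ⌈A⌉ ⌊B⌋).card := by
    exact_mod_cast Finset.card_le_card fun j hj => (Finset.mem_filter.1 hj).2
  refine h2.trans ?_
  rw [Int.card_Icc]
  have h3 : (((⌊B⌋ + 1 - ⌈A⌉).toNat : ℕ) : ℝ) ≤ max (B + 1 - A) 0 := by
    have e : (((⌊B⌋ + 1 - ⌈A⌉).toNat : ℕ) : ℝ) = ((max (⌊B⌋ + 1 - ⌈A⌉) 0 : ℤ) : ℝ) := by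
      rw [← Int.ofNat_toNat, Int.cast_natCast]
    rw [e]
    push_cast
    exact max_le_max (by linarith [Int.floor_le B, Int.le_ceil A]) le_rfl
  rw [max_eq_left (by linarith)] at h3
  have h4 : B + 1 - A = (v - u) / d + 2 * (r / d) + 2 := by rw [hA, hB]; ring
  have h5 : r / d ≤ 1 := (div_le_one hd).2 hrd
  linarith

/-- A probability measure on `[a, b]` which is a combination of Lebesgue measures on intervals of
many different scales satisfies a Frostman-type bound with arbitrarily small constant. -/
theorem exists_weighted_intervals {s c : ℝ} (hs : 0 < s) (hs1 : s < 1) (hc : 0 < c) {r d : ℕ → ℝ}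
    (hr : ∀ t, 0 < r t) (hrr : ∀ t, r (t + 1) ≤ r t / 2) (hrd : ∀ t, r t ≤ d t) {T : Set ℕ}
    (hdiv : ∀ (t₀ : ℕ) (S : ℝ), ∃ F : Finset ℕ, (∀ t ∈ F, t ∈ T ∧ t₀ ≤ t) ∧
      S ≤ ∑ t ∈ F, r t ^ s / d t) {a b : ℝ} (hab : a < b) {E : Set ℝ}
    (hJ : ∃ t₀ : ℕ, ∀ t ∈ T, t₀ ≤ t → ∃ (J : Finset ℤ) (p : ℤ → ℝ), c * (b - a) ≤ J.card * d t ∧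
      ∀ j ∈ J, p j ∈ Icc (j * d t) ((j + 1) * d t) ∧ Icc (p j - r t) (p j + r t) ⊆ E)
    {δ : ℝ} (hδ : 0 < δ) :
    ∃ (F : Finset ((_ : ℕ) × ℤ)) (w x y : ((_ : ℕ) × ℤ) → ℝ),
      (∀ i ∈ F, 0 ≤ w i ∧ x i < y i ∧ Icc (x i) (y i) ⊆ E) ∧
      ∑ i ∈ F, w i * (y i - x i) = 1 ∧
      ∀ u v, u < v → ∑ i ∈ F, ENNReal.ofReal (w i) * volume (Icc u v ∩ Icc (x i) (y i)) ≤
        ENNReal.ofReal (1 / c / (b - a) * (v - u) + δ * (v - u) ^ s) := by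
  classical
  obtain ⟨A, hA, hAbound⟩ := exists_sum_rpow_mul_min_le hs hs1
  obtain ⟨t₀, ht₀⟩ := hJ
  have hlen := sub_pos.2 hab
  have hd : ∀ t, 0 < d t := fun t => (hr t).trans_le (hrd t)
  obtain ⟨F, hF, hS⟩ := hdiv t₀ (4 * A / (c * (b - a) * δ))
  have hex : ∀ t, ∃ (J : Finset ℤ) (p : ℤ → ℝ), t ∈ F → c * (b - a) ≤ J.card * d t ∧
      ∀ j ∈ J, p j ∈ Icc (j * d t) ((j + 1) * d t) ∧ Icc (p j - r t) (p j + r t) ⊆ E := by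
    intro t
    by_cases ht : t ∈ F
    · obtain ⟨J, p, h⟩ := ht₀ t (hF t ht).1 (hF t ht).2
      exact ⟨J, p, fun _ => h⟩
    · exact ⟨∅, 0, fun h => absurd h ht⟩
  choose J p hJp using hex
  set S := ∑ t ∈ F, r t ^ s / d t with hSdef
  set S₀ := ∑ t ∈ F, (J t).card * r t ^ s with hS₀def
  have hS0 : 0 < S := lt_of_lt_of_le (by positivity) hS
  have hS₀ : c * (b - a) * S ≤ S₀ := by
    rw [hSdef, hS₀def, Finset.mul_sum]
    refine Finset.sum_le_sum fun t ht => ?_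
    rw [mul_div_assoc', div_le_iff₀ (hd t)]
    have := mul_le_mul_of_nonneg_right (hJp t ht).1 (Real.rpow_nonneg (hr t).le s)
    linarith
  have hS₀0 : 0 < S₀ := lt_of_lt_of_le (by positivity) hS₀
  clear_value S S₀
  have hmul : ∀ t, r t ^ (s - 1) * r t = r t ^ s := by
    intro t
    nth_rewrite 2 [← Real.rpow_one (r t)]
    rw [← Real.rpow_add (hr t)]
    ring_nf
  refine ⟨F.sigma J, fun i => r i.1 ^ (s - 1) / (2 * S₀), fun i => p i.1 i.2 - r i.1,
    fun i => p i.1 i.2 + r i.1, ?_, ?_, ?_⟩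
  · intro i hi
    obtain ⟨hi1, hi2⟩ := Finset.mem_sigma.1 hi
    exact ⟨div_nonneg (Real.rpow_nonneg (hr _).le _) (by positivity),
      by linarith [hr i.1], ((hJp _ hi1).2 _ hi2).2⟩
  · rw [Finset.sum_sigma]
    have e : ∀ t ∈ F, ∑ j ∈ J t, r t ^ (s - 1) / (2 * S₀) * (p t j + r t - (p t j - r t)) =
        (J t).card * r t ^ s / S₀ := by
      intro t _
      rw [← hmul t]
      have : ∀ j ∈ J t, r t ^ (s - 1) / (2 * S₀) * (p t j + r t - (p t j - r t)) =
          r t ^ (s - 1) * r t / S₀ := fun j _ => by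
        rw [div_mul_eq_mul_div, div_eq_div_iff (by positivity) hS₀0.ne']
        ring
      rw [Finset.sum_congr rfl this, Finset.sum_const, nsmul_eq_mul]
      ring
    rw [Finset.sum_congr rfl e, ← Finset.sum_div, ← hS₀def, div_self hS₀0.ne']
  · intro u v huv
    have hρ := sub_pos.2 huv
    rw [Finset.sum_sigma]
    have h1 : ∀ t ∈ F, ∑ j ∈ J t, ENNReal.ofReal (r t ^ (s - 1) / (2 * S₀)) *
        volume (Icc u v ∩ Icc (p t j - r t) (p t j + r t)) ≤
        ENNReal.ofReal (1 / S₀ * ((v - u) * (r t ^ s / d t) +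
          4 * (r t ^ (s - 1) * min (v - u) (r t)))) := by
      intro t ht
      have hw : 0 ≤ r t ^ (s - 1) / (2 * S₀) :=
        div_nonneg (Real.rpow_nonneg (hr _).le _) (by positivity)
      rw [← Finset.mul_sum]
      refine (mul_le_mul_right (sum_volume_inter_le (hd t) (hr t).le (hrd t) huv.le
        fun j hj => ((hJp t ht).2 j hj).1) _).trans ?_
      rw [← ENNReal.ofReal_mul hw]
      refine ENNReal.ofReal_le_ofReal ?_
      have hm1 : min (v - u) (2 * r t) ≤ 2 * min (v - u) (r t) := by
        rw [mul_min_of_nonneg _ _ zero_le_two]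
        exact min_le_min_right _ (by linarith)
      have hm2 : min (v - u) (2 * r t) ≤ 2 * r t := min_le_right _ _
      have hq : 0 ≤ (v - u) / d t := (div_pos hρ (hd t)).le
      calc r t ^ (s - 1) / (2 * S₀) * (((v - u) / d t + 4) * min (v - u) (2 * r t))
          ≤ r t ^ (s - 1) / (2 * S₀) * ((v - u) / d t * (2 * r t) +
            4 * (2 * min (v - u) (r t))) := by
            refine mul_le_mul_of_nonneg_left ?_ hw
            nlinarith [mul_le_mul_of_nonneg_left hm2 hq]
        _ = _ := by
            rw [← hmul t]
            field_simp
    refine (Finset.sum_le_sum h1).trans ?_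
    have hpos : ∀ t ∈ F, 0 ≤ 1 / S₀ * ((v - u) * (r t ^ s / d t) +
          4 * (r t ^ (s - 1) * min (v - u) (r t))) := by
      intro t _
      have := hr t
      have := hd t
      have : 0 < min (v - u) (r t) := lt_min hρ (hr t)
      positivity
    rw [← ENNReal.ofReal_sum_of_nonneg hpos, ← Finset.mul_sum, Finset.sum_add_distrib,
      ← Finset.mul_sum, ← Finset.mul_sum]
    refine ENNReal.ofReal_le_ofReal ?_
    have h2 := hAbound r hr hrr (v - u) hρ F
    have hρs : 0 < (v - u) ^ s := Real.rpow_pos_of_pos hρ _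
    rw [div_le_iff₀ (by positivity)] at hS
    have h3 : 4 * A ≤ δ * S₀ := by nlinarith
    rw [one_div_mul_eq_div, div_le_iff₀ hS₀0, ← hSdef, add_mul]
    have h4 : (v - u) * S ≤ 1 / c / (b - a) * (v - u) * S₀ := by
      have e : 1 / c / (b - a) * (v - u) * S₀ = (v - u) * (S₀ / (c * (b - a))) := by
        field_simp
      rw [e]
      refine mul_le_mul_of_nonneg_left ?_ hρ.le
      rw [le_div_iff₀ (by positivity)]
      linarith
    nlinarith

end Block

section NestedIntervals

open Set
open scoped Topology ENNReal

theorem exists_Ioo_cover {X : Set ℝ} {s ε : ℝ} (hs : 0 < s) (hs1 : s < 1) (hε : 0 < ε)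
    (hX : μH[s] X ≠ ⊤) :
    ∃ u v : ℕ → ℝ, (∀ n, u n < v n) ∧ X ⊆ ⋃ n, Ioo (u n) (v n) ∧
      Summable (fun n => (v n - u n) ^ s) ∧
      ∑' n, ENNReal.ofReal (v n - u n) ≤ ENNReal.ofReal ε := by
  classical
  set S := (μH[s] X).toReal + 1 with hS
  have hS0 : 0 < S := by positivity
  have hXS : μH[s] X < ENNReal.ofReal S := by
    rw [← ENNReal.ofReal_toReal hX]
    exact (ENNReal.ofReal_lt_ofReal_iff hS0).2 (by linarith)
  set r : ℝ := (ε / (8 * S)) ^ (1 / (1 - s)) with hr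
  have hr0 : 0 < r := by positivity
  have hrs : r ^ (1 - s) = ε / (8 * S) := by
    rw [hr, ← Real.rpow_mul (by positivity), one_div_mul_cancel (by linarith), Real.rpow_one]
  rw [Measure.hausdorffMeasure_apply] at hXS
  have hlt := (le_iSup₂ (f := fun (r : ℝ≥0∞) (_ : 0 < r) =>
    ⨅ (t : ℕ → Set ℝ) (_ : X ⊆ ⋃ n, t n) (_ : ∀ n, Metric.ediam (t n) ≤ r),
      ∑' n, ⨆ _ : (t n).Nonempty, Metric.ediam (t n) ^ s) (ENNReal.ofReal r)
    (ENNReal.ofReal_pos.2 hr0)).trans_lt hXS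
  simp only [iInf_lt_iff] at hlt
  obtain ⟨t, hcov, hdiam, hsum⟩ := hlt
  have hne : ∀ n, Metric.ediam (t n) ≠ ⊤ := fun n =>
    ne_top_of_le_ne_top ENNReal.ofReal_ne_top (hdiam n)
  set D : ℕ → ℝ := fun n => (Metric.ediam (t n)).toReal with hD
  have hD0 : ∀ n, 0 ≤ D n := fun n => ENNReal.toReal_nonneg
  have hDr : ∀ n, D n ≤ r := fun n => ENNReal.toReal_le_of_le_ofReal hr0.le (hdiam n)
  have hDs : ∑' n, ENNReal.ofReal (D n ^ s) ≤ ENNReal.ofReal S := by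
    refine (ENNReal.tsum_le_tsum fun n => ?_).trans hsum.le
    rw [← ENNReal.ofReal_rpow_of_nonneg (hD0 n) hs.le, ENNReal.ofReal_toReal (hne n)]
    rcases (t n).eq_empty_or_nonempty with h | h
    · rw [h, Metric.ediam_empty, ENNReal.zero_rpow_of_pos hs]
      exact zero_le
    · exact le_iSup (fun _ : (t n).Nonempty => Metric.ediam (t n) ^ s) h
  have hDsum : Summable fun n => D n ^ s := by
    have := ENNReal.summable_toReal (ne_top_of_le_ne_top ENNReal.ofReal_ne_top hDs)
    refine this.congr fun n => ?_
    rw [ENNReal.toReal_ofReal (Real.rpow_nonneg (hD0 n) _)]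
  have hDle : ∀ n, D n ≤ ε / (8 * S) * D n ^ s := by
    intro n
    rcases (hD0 n).eq_or_lt with h | h
    · rw [← h, Real.zero_rpow hs.ne', mul_zero]
    · rw [← hrs]
      calc D n = D n ^ (1 - s) * D n ^ s := by
            rw [← Real.rpow_add h]; simp
        _ ≤ _ := mul_le_mul_of_nonneg_right
            (Real.rpow_le_rpow h.le (hDr n) (by linarith)) (Real.rpow_nonneg h.le _)
  have hD1 : ∑' n, ENNReal.ofReal (D n) ≤ ENNReal.ofReal (ε / 8) := by
    calc ∑' n, ENNReal.ofReal (D n)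
        ≤ ∑' n, ENNReal.ofReal (ε / (8 * S)) * ENNReal.ofReal (D n ^ s) := by
          refine ENNReal.tsum_le_tsum fun n => ?_
          rw [← ENNReal.ofReal_mul (by positivity)]
          exact ENNReal.ofReal_le_ofReal (hDle n)
      _ ≤ ENNReal.ofReal (ε / (8 * S)) * ENNReal.ofReal S := by
          rw [ENNReal.tsum_mul_left]
          exact mul_le_mul_right hDs _
      _ = ENNReal.ofReal (ε / 8) := by
          rw [← ENNReal.ofReal_mul (by positivity)]
          congr 1
          field_simp
  set η : ℕ → ℝ := fun n => ε / 16 * (1 / 2) ^ n with hη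
  have hη0 : ∀ n, 0 < η n := fun n => by positivity
  have hη1 : ∑' n, ENNReal.ofReal (η n) = ENNReal.ofReal (ε / 8) := by
    rw [← ENNReal.ofReal_tsum_of_nonneg (fun n => (hη0 n).le)
      (summable_geometric_two.mul_left _), tsum_mul_left, tsum_geometric_two]
    congr 1
    ring
  have hηs : Summable fun n => η n ^ s := by
    have : ∀ n, η n ^ s = (ε / 16) ^ s * ((1 / 2) ^ s) ^ n := by
      intro n
      rw [hη, Real.mul_rpow (by positivity) (by positivity), ← Real.rpow_natCast,
        ← Real.rpow_natCast, ← Real.rpow_mul (by norm_num), ← Real.rpow_mul (by norm_num),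
        mul_comm s]
    simp_rw [this]
    exact (summable_geometric_of_lt_one (by positivity)
      (Real.rpow_lt_one (by norm_num) (by norm_num) hs)).mul_left _
  have hx : ∀ n, ∃ x : ℝ, ∀ y ∈ t n, |y - x| ≤ D n := by
    intro n
    rcases (t n).eq_empty_or_nonempty with h | ⟨x, hx⟩
    · exact ⟨0, by simp [h]⟩
    · refine ⟨x, fun y hy => ?_⟩
      rw [← Real.dist_eq, dist_edist]
      exact ENNReal.toReal_mono (hne n) (Metric.edist_le_ediam_of_mem hy hx)
  choose x hx using hx
  have hlen : ∀ n, x n + (D n + η n) - (x n - (D n + η n)) = 2 * (D n + η n) := fun n => by ring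
  refine ⟨fun n => x n - (D n + η n), fun n => x n + (D n + η n), fun n => ?_, fun y hy => ?_,
    ?_, ?_⟩
  · linarith [hD0 n, hη0 n]
  · obtain ⟨n, hn⟩ := mem_iUnion.1 (hcov hy)
    have := abs_le.1 (hx n y hn)
    exact mem_iUnion.2 ⟨n, by linarith [hη0 n], by linarith [hη0 n]⟩
  · simp_rw [hlen]
    refine Summable.of_nonneg_of_le (fun n => Real.rpow_nonneg (by linarith [hD0 n, hη0 n]) _)
      (fun n => ?_) ((hDsum.add hηs).mul_left (2 ^ s))
    rw [Real.mul_rpow (by norm_num) (by linarith [hD0 n, hη0 n])]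
    exact mul_le_mul_of_nonneg_left
      (Real.rpow_add_le_add_rpow (hD0 n) (hη0 n).le hs.le hs1.le) (by positivity)
  · simp_rw [hlen]
    have : ∀ n, ENNReal.ofReal (2 * (D n + η n)) =
        2 * (ENNReal.ofReal (D n) + ENNReal.ofReal (η n)) := by
      intro n
      rw [ENNReal.ofReal_mul (by norm_num), ENNReal.ofReal_add (hD0 n) (hη0 n).le]
      simp
    simp_rw [this]
    rw [ENNReal.tsum_mul_left, ENNReal.tsum_add, hη1]
    calc 2 * (∑' n, ENNReal.ofReal (D n) + ENNReal.ofReal (ε / 8))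
        ≤ 2 * (ENNReal.ofReal (ε / 8) + ENNReal.ofReal (ε / 8)) := by gcongr
      _ = ENNReal.ofReal (2 * (ε / 8 + ε / 8)) := by
          rw [ENNReal.ofReal_mul (by norm_num), ENNReal.ofReal_add (by positivity) (by positivity)]
          simp
      _ ≤ ENNReal.ofReal ε := ENNReal.ofReal_le_ofReal (by linarith)

/-- If a family of measurable sets covers, with multiplicity, at most half of an interval, then it
covers very little of some short subinterval. -/
theorem exists_Icc_subset_tsum_volume_le {U : ℕ → Set ℝ} (hU : ∀ n, MeasurableSet (U n))
    (hfin : ∑' n, volume (U n) ≠ ⊤) {a b : ℝ} (hab : a < b)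
    (hhalf : ∑' n, volume (U n ∩ Icc a b) ≤ ENNReal.ofReal ((b - a) / 2)) {ε η : ℝ} (hε : 0 < ε)
    (hη : 0 < η) :
    ∃ x y, a ≤ x ∧ x < y ∧ y ≤ b ∧ y - x < η ∧
      ∑' n, volume (U n ∩ Icc x y) ≤ ENNReal.ofReal (ε * (y - x)) := by
  set φ : ℝ → ℝ≥0∞ := fun x => ∑' n, (U n).indicator 1 x with hφ
  have hφm : Measurable φ := Measurable.tsum fun n => measurable_one.indicator (hU n)
  have hφint : ∀ A : Set ℝ, ∫⁻ x in A, φ x = ∑' n, volume (U n ∩ A) := by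
    intro A
    rw [hφ, lintegral_tsum fun n => (measurable_one.indicator (hU n)).aemeasurable]
    refine tsum_congr fun n => ?_
    rw [lintegral_indicator_one (hU n), Measure.restrict_apply (hU n)]
  have hφfin : ∫⁻ x, φ x ≠ ⊤ := by
    have := hφint univ
    simp only [Measure.restrict_univ, inter_univ] at this
    rwa [this]
  have hae := (IsUnifLocDoublingMeasure.vitaliFamily (volume : Measure ℝ) 1).ae_tendsto_lintegral_div
    hφm.aemeasurable hφfin
  obtain ⟨x, hxI, hx0, hx⟩ : ∃ x ∈ Ico a b, φ x = 0 ∧ Tendsto (fun A => (∫⁻ y in A, φ y) / volume A)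
      ((IsUnifLocDoublingMeasure.vitaliFamily (volume : Measure ℝ) 1).filterAt x) (𝓝 (φ x)) := by
    by_contra! hcon
    have h1 : ∀ᵐ x ∂(volume.restrict (Ico a b)), 1 ≤ φ x := by
      rw [ae_restrict_iff' measurableSet_Ico]
      filter_upwards [hae] with x hx hxI
      by_contra! hlt
      refine hcon x hxI ?_ hx
      rw [hφ] at hlt ⊢
      rw [ENNReal.tsum_eq_zero]
      intro n
      by_contra hn
      have : x ∈ U n := by
        by_contra h
        exact hn (indicator_of_notMem h _)
      refine absurd (ENNReal.le_tsum (f := fun n => (U n).indicator (1 : ℝ → ℝ≥0∞) x) n)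
        (not_le.2 (hlt.trans_le ?_))
      simp [this]
    have h2 := lintegral_mono_ae h1
    rw [lintegral_one, Measure.restrict_apply_univ, Real.volume_Ico] at h2
    have h3 : ∫⁻ x in Ico a b, φ x ≤ ENNReal.ofReal ((b - a) / 2) :=
      (lintegral_mono_set Ico_subset_Icc_self).trans ((hφint _).le.trans hhalf)
    have h4 := (ENNReal.ofReal_le_ofReal_iff (by linarith)).1 (h2.trans h3)
    linarith
  rw [hx0] at hx
  have hev := (hx.comp (Real.tendsto_Icc_vitaliFamily_right x)).eventually
    (gt_mem_nhds (ENNReal.ofReal_pos.2 hε))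
  have hmem : ∀ᶠ y in 𝓝[>] x, y ∈ Ioo x (min b (x + η)) :=
    Ioo_mem_nhdsGT (lt_min hxI.2 (by linarith))
  obtain ⟨y, hy, hyI⟩ := (hev.and hmem).exists
  have hyb := hyI.2.trans_le (min_le_left _ _)
  have hyη := hyI.2.trans_le (min_le_right _ _)
  refine ⟨x, y, hxI.1, hyI.1, hyb.le, by linarith, ?_⟩
  simp only [Function.comp_apply, hφint, Real.volume_Icc] at hy
  rw [ENNReal.div_lt_iff (Or.inl (ENNReal.ofReal_pos.2 (by linarith [hyI.1])).ne')
    (Or.inl ENNReal.ofReal_ne_top), ← ENNReal.ofReal_mul hε.le] at hy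
  exact hy.le

theorem exists_tsum_volume_inter_le_half {ι : Type} {F : Finset ι} {w x y : ι → ℝ} {a b s C δ ε : ℝ}
    (hab : a < b) (hC : 0 ≤ C) (hδ : 0 ≤ δ) (hs : 0 < s) (hε : 0 ≤ ε)
    (hF : ∀ i ∈ F, 0 ≤ w i ∧ x i < y i ∧ Icc (x i) (y i) ⊆ Icc a b)
    (hw : ∑ i ∈ F, w i * (y i - x i) = 1)
    (hFr : ∀ u v, u < v → ∑ i ∈ F, ENNReal.ofReal (w i) * volume (Icc u v ∩ Icc (x i) (y i)) ≤
        ENNReal.ofReal (C / (b - a) * (v - u) + δ * (v - u) ^ s))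
    {u v : ℕ → ℝ} (huv : ∀ n, u n < v n) (hsum : Summable fun n => (v n - u n) ^ s)
    (hU : ∑' n, volume (Ioo (u n) (v n) ∩ Icc a b) ≤ ENNReal.ofReal (ε * (b - a)))
    (hCε : C * ε ≤ 1 / 8) (hδs : δ * ∑' n, (v n - u n) ^ s ≤ 1 / 8) :
    ∃ i ∈ F, ∑' n, volume (Ioo (u n) (v n) ∩ Icc (x i) (y i)) ≤
      ENNReal.ofReal ((y i - x i) / 2) := by
  by_contra! hcon
  have hlen := sub_pos.2 hab
  have hn : ∀ n, ∑ i ∈ F, ENNReal.ofReal (w i) * volume (Ioo (u n) (v n) ∩ Icc (x i) (y i)) ≤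
      ENNReal.ofReal (C / (b - a)) * volume (Ioo (u n) (v n) ∩ Icc a b) +
        ENNReal.ofReal (δ * (v n - u n) ^ s) := by
    intro n
    have hvol : ENNReal.ofReal (min (v n) b - max (u n) a) ≤
        volume (Ioo (u n) (v n) ∩ Icc a b) := by
      rw [← Real.volume_Ioo]
      refine measure_mono fun z hz => ⟨⟨(le_max_left _ _).trans_lt hz.1,
        hz.2.trans_le (min_le_left _ _)⟩, ((le_max_right _ _).trans_lt hz.1).le,
        (hz.2.trans_le (min_le_right _ _)).le⟩
    have hsub : ∀ i ∈ F, Ioo (u n) (v n) ∩ Icc (x i) (y i) ⊆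
        Icc (max (u n) a) (min (v n) b) ∩ Icc (x i) (y i) := by
      intro i hi z hz
      have := (hF i hi).2.2 hz.2
      exact ⟨⟨max_le hz.1.1.le this.1, le_min hz.1.2.le this.2⟩, hz.2⟩
    rcases lt_or_ge (max (u n) a) (min (v n) b) with hlt | hge
    · calc ∑ i ∈ F, ENNReal.ofReal (w i) * volume (Ioo (u n) (v n) ∩ Icc (x i) (y i))
          ≤ ∑ i ∈ F, ENNReal.ofReal (w i) *
              volume (Icc (max (u n) a) (min (v n) b) ∩ Icc (x i) (y i)) :=
            Finset.sum_le_sum fun i hi => mul_le_mul_right (measure_mono (hsub i hi)) _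
        _ ≤ _ := hFr _ _ hlt
        _ = ENNReal.ofReal (C / (b - a)) * ENNReal.ofReal (min (v n) b - max (u n) a) +
              ENNReal.ofReal (δ * (min (v n) b - max (u n) a) ^ s) := by
            have h1 : 0 ≤ min (v n) b - max (u n) a := by linarith
            rw [ENNReal.ofReal_add (by positivity) (by positivity),
              ENNReal.ofReal_mul (by positivity)]
        _ ≤ _ := by
            refine add_le_add (mul_le_mul_right hvol _) (ENNReal.ofReal_le_ofReal
              (mul_le_mul_of_nonneg_left (Real.rpow_le_rpow (by linarith) ?_ hs.le) hδ))
            linarith [le_max_left (u n) a, min_le_left (v n) b]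
    · have : ∀ i ∈ F, ENNReal.ofReal (w i) * volume (Ioo (u n) (v n) ∩ Icc (x i) (y i)) = 0 := by
        intro i hi
        have h0 : volume (Ioo (u n) (v n) ∩ Icc (x i) (y i)) = 0 := by
          refine measure_mono_null ((hsub i hi).trans inter_subset_left) ?_
          rw [Real.volume_Icc, ENNReal.ofReal_eq_zero]
          linarith
        rw [h0, mul_zero]
      rw [Finset.sum_eq_zero this]
      exact zero_le
  have hup : ∑ i ∈ F, ENNReal.ofReal (w i) * ∑' n, volume (Ioo (u n) (v n) ∩ Icc (x i) (y i)) ≤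
      ENNReal.ofReal (1 / 4) := by
    calc ∑ i ∈ F, ENNReal.ofReal (w i) * ∑' n, volume (Ioo (u n) (v n) ∩ Icc (x i) (y i))
        = ∑' n, ∑ i ∈ F, ENNReal.ofReal (w i) *
            volume (Ioo (u n) (v n) ∩ Icc (x i) (y i)) := by
          simp_rw [← ENNReal.tsum_mul_left]
          exact (Summable.tsum_finsetSum fun _ _ => ENNReal.summable).symm
      _ ≤ ∑' n, (ENNReal.ofReal (C / (b - a)) * volume (Ioo (u n) (v n) ∩ Icc a b) +
            ENNReal.ofReal (δ * (v n - u n) ^ s)) := ENNReal.tsum_le_tsum hn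
      _ = ENNReal.ofReal (C / (b - a)) * ∑' n, volume (Ioo (u n) (v n) ∩ Icc a b) +
            ENNReal.ofReal (δ * ∑' n, (v n - u n) ^ s) := by
          rw [ENNReal.tsum_add, ENNReal.tsum_mul_left, ← tsum_mul_left,
            ENNReal.ofReal_tsum_of_nonneg (fun n => mul_nonneg hδ
              (Real.rpow_nonneg (sub_pos.2 (huv n)).le _)) (hsum.mul_left δ)]
      _ ≤ ENNReal.ofReal (C / (b - a)) * ENNReal.ofReal (ε * (b - a)) +
            ENNReal.ofReal (1 / 8) :=
          add_le_add (mul_le_mul_right hU _) (ENNReal.ofReal_le_ofReal hδs)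
      _ = ENNReal.ofReal (C * ε + 1 / 8) := by
          rw [← ENNReal.ofReal_mul (by positivity), ← ENNReal.ofReal_add (by positivity)
            (by positivity)]
          congr 2
          field_simp
      _ ≤ ENNReal.ofReal (1 / 4) := ENNReal.ofReal_le_ofReal (by linarith)
  have hlow : ENNReal.ofReal (1 / 2) ≤
      ∑ i ∈ F, ENNReal.ofReal (w i) * ∑' n, volume (Ioo (u n) (v n) ∩ Icc (x i) (y i)) := by
    have e : (1 / 2 : ℝ) = ∑ i ∈ F, w i * ((y i - x i) / 2) := by
      rw [← hw, Finset.sum_div]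
      exact Finset.sum_congr rfl fun i _ => by ring
    rw [e, ENNReal.ofReal_sum_of_nonneg fun i hi => mul_nonneg (hF i hi).1
      (by linarith [(hF i hi).2.1])]
    refine Finset.sum_le_sum fun i hi => ?_
    rw [ENNReal.ofReal_mul (hF i hi).1]
    exact mul_le_mul_right (hcon i hi).le _
  have := (ENNReal.ofReal_le_ofReal_iff (by norm_num)).1 (hlow.trans hup)
  norm_num at this

/-- A set of points lying in infinitely many members of a limsup scheme has infinite Hausdorff
measure as soon as every interval carries Frostman measures with arbitrarily small constants on
each member of the scheme. -/
theorem hausdorffMeasure_eq_top_of_weighted_intervals {ι : Type} {s C α β : ℝ} (hs : 0 < s)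
    (hs1 : s < 1) (hC : 0 < C) (hαβ : α < β) {G : ℕ → Set ℝ}
    (H : ∀ a b (k : ℕ) δ, α ≤ a → a < b → b ≤ β → 0 < δ →
      ∃ (F : Finset ι) (w x y : ι → ℝ),
        (∀ i ∈ F, 0 ≤ w i ∧ x i < y i ∧ Icc (x i) (y i) ⊆ Icc a b ∩ G k) ∧
        ∑ i ∈ F, w i * (y i - x i) = 1 ∧
        ∀ u v, u < v → ∑ i ∈ F, ENNReal.ofReal (w i) * volume (Icc u v ∩ Icc (x i) (y i)) ≤
          ENNReal.ofReal (C / (b - a) * (v - u) + δ * (v - u) ^ s)) :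
    μH[s] {x | x ∈ Icc α β ∧ ∀ k, x ∈ G k} = ⊤ := by
  by_contra hX
  set ε : ℝ := min (1 / 2) (1 / (8 * C)) with hε
  have hε0 : 0 < ε := by positivity
  have hCε : C * ε ≤ 1 / 8 := by
    have := mul_le_mul_of_nonneg_left (min_le_right (1 / 2) (1 / (8 * C))) hC.le
    refine this.trans (le_of_eq ?_)
    field_simp
  have hε1 : ε ≤ 1 / 2 := min_le_left _ _
  obtain ⟨u, v, huv, hcov, hsum, hlen⟩ :=
    exists_Ioo_cover hs hs1 (mul_pos hε0 (sub_pos.2 hαβ)) hX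
  set Θ := ∑' n, (v n - u n) ^ s with hΘ
  have hΘ0 : 0 ≤ Θ := tsum_nonneg fun n => Real.rpow_nonneg (sub_pos.2 (huv n)).le _
  have hfin : ∑' n, volume (Ioo (u n) (v n)) ≠ ⊤ := by
    simp_rw [Real.volume_Ioo]
    exact ne_top_of_le_ne_top ENNReal.ofReal_ne_top hlen
  set P : ℝ × ℝ → Prop := fun p => α ≤ p.1 ∧ p.1 < p.2 ∧ p.2 ≤ β ∧
    ∑' n, volume (Ioo (u n) (v n) ∩ Icc p.1 p.2) ≤ ENNReal.ofReal (ε * (p.2 - p.1)) with hP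
  have hstep : ∀ (k : ℕ) (p : {p // P p}), ∃ p' : {p // P p}, p.1.1 ≤ p'.1.1 ∧ p'.1.2 ≤ p.1.2 ∧
      Icc p'.1.1 p'.1.2 ⊆ G k ∧ p'.1.2 - p'.1.1 < 1 / (k + 1) := by
    rintro k ⟨⟨a, b⟩, ha, hab, hb, hvol⟩
    simp only at ha hab hb hvol
    obtain ⟨F, w, x, y, hF, hw, hFr⟩ := H a b k (1 / (8 * (Θ + 1))) ha hab hb (by positivity)
    obtain ⟨i, hi, hi'⟩ := exists_tsum_volume_inter_le_half hab hC.le (by positivity) hs hε0.le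
      (fun i hi => ⟨(hF i hi).1, (hF i hi).2.1, (hF i hi).2.2.trans inter_subset_left⟩) hw hFr
      huv hsum hvol hCε (by rw [← hΘ, one_div_mul_eq_div, div_le_iff₀ (by positivity)]; linarith)
    obtain ⟨x', y', h1, h2, h3, h4, h5⟩ := exists_Icc_subset_tsum_volume_le
      (fun n => measurableSet_Ioo) hfin (hF i hi).2.1 hi' hε0
      (show (0 : ℝ) < 1 / (k + 1) by positivity)
    have hsub := (hF i hi).2.2
    have hxi := hsub (left_mem_Icc.2 (hF i hi).2.1.le)
    have hyi := hsub (right_mem_Icc.2 (hF i hi).2.1.le)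
    exact ⟨⟨(x', y'), ha.trans (hxi.1.1.trans h1), h2, h3.trans (hyi.1.2.trans hb), h5⟩,
      hxi.1.1.trans h1, h3.trans hyi.1.2,
      (Icc_subset_Icc h1 h3).trans (hsub.trans inter_subset_right), h4⟩
  choose nxt hnxt using hstep
  have hstart : P (α, β) := by
    refine ⟨le_rfl, hαβ, le_rfl, le_trans (ENNReal.tsum_le_tsum fun n => ?_) hlen⟩
    rw [← Real.volume_Ioo]
    exact measure_mono inter_subset_left
  set J : ℕ → {p // P p} := fun k => Nat.rec ⟨(α, β), hstart⟩ nxt k with hJ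
  have hJs : ∀ k, J (k + 1) = nxt k (J k) := fun k => rfl
  have hanti : Antitone fun k => Icc (J k).1.1 (J k).1.2 := by
    refine antitone_nat_of_succ_le fun k => ?_
    rw [hJs]
    exact Icc_subset_Icc (hnxt k (J k)).1 (hnxt k (J k)).2.1
  have hx := ciSup_mem_iInter_Icc_of_antitone_Icc hanti fun k => (J k).2.2.1.le
  rw [mem_iInter] at hx
  set x := ⨆ k, (J k).1.1
  have hxX : x ∈ {x | x ∈ Icc α β ∧ ∀ k, x ∈ G k} := by
    refine ⟨hx 0, fun k => ?_⟩
    have := hx (k + 1)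
    rw [hJs] at this
    exact (hnxt k (J k)).2.2.1 this
  obtain ⟨n, hn⟩ := mem_iUnion.1 (hcov hxX)
  obtain ⟨k, hk⟩ := exists_nat_one_div_lt (lt_min (sub_pos.2 hn.1) (sub_pos.2 hn.2))
  have hlt := (hnxt k (J k)).2.2.2
  rw [← hJs] at hlt
  have hxk := hx (k + 1)
  obtain ⟨-, hJ1, -, hJ2⟩ := (J (k + 1)).2
  have hsub : Icc (J (k + 1)).1.1 (J (k + 1)).1.2 ⊆ Ioo (u n) (v n) := by
    intro z hz
    have h1 := hk.trans_le (min_le_left _ _)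
    have h2 := hk.trans_le (min_le_right _ _)
    exact ⟨by linarith [hz.1, hxk.2], by linarith [hz.2, hxk.1]⟩
  have h1 := (ENNReal.le_tsum (f := fun n => volume (Ioo (u n) (v n) ∩
    Icc (J (k + 1)).1.1 (J (k + 1)).1.2)) n).trans hJ2
  simp only [inter_eq_self_of_subset_right hsub, Real.volume_Icc] at h1
  have h2 := (ENNReal.ofReal_le_ofReal_iff (by nlinarith)).1 h1
  nlinarith

end NestedIntervals

section DyadicScales

open Set

variable {ψ : ℝ → ℝ} {s : ℝ}

theorem not_summable_two_pow (hψ : IsApproxFun ψ) (hs : 0 < s) (hs1 : s < 1)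
    (hdiv : ¬ Summable (fun h : ℕ => (h : ℝ) ^ (1 - s) * ψ h ^ (s + 1))) :
    ¬ Summable (fun t : ℕ => ((2 : ℝ) ^ t) ^ (2 - s) * ψ (2 ^ t) ^ (s + 1)) := by
  intro hsum
  have hnonneg : ∀ h : ℕ, 0 ≤ (h : ℝ) ^ (1 - s) * ψ h ^ (s + 1) := by
    intro h
    rcases Nat.eq_zero_or_pos h with rfl | hh
    · simp [Real.zero_rpow (show 1 - s ≠ 0 by linarith)]
    · have := hψ.2 h (by exact_mod_cast hh)
      positivity
  have hpow : ∀ t : ℕ, 0 < ψ (2 ^ t) := fun t => hψ.2 _ (by positivity)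
  have hblock : ∀ n : ℕ, ∑ h ∈ Finset.range (2 ^ n), (h : ℝ) ^ (1 - s) * ψ h ^ (s + 1) ≤
      ∑ t ∈ Finset.range n, 2 * (((2 : ℝ) ^ t) ^ (2 - s) * ψ (2 ^ t) ^ (s + 1)) := by
    intro n
    induction n with
    | zero => simp [Real.zero_rpow (show 1 - s ≠ 0 by linarith)]
    | succ n ih =>
      rw [Finset.sum_range_succ, ← Finset.sum_range_add_sum_Ico _
        (Nat.pow_le_pow_right two_pos n.le_succ)]
      refine add_le_add ih ?_
      have hterm : ∀ h : ℕ, h ∈ Finset.Ico (2 ^ n) (2 ^ (n + 1)) →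
          (h : ℝ) ^ (1 - s) * ψ h ^ (s + 1) ≤
            ((2 : ℝ) ^ (n + 1)) ^ (1 - s) * ψ (2 ^ n) ^ (s + 1) := by
        intro h hh
        rw [Finset.mem_Ico] at hh
        have h1 : (2 : ℝ) ^ n ≤ h := by exact_mod_cast hh.1
        have h2 : (h : ℝ) ≤ 2 ^ (n + 1) := by exact_mod_cast hh.2.le
        have h0 : (0 : ℝ) < h := lt_of_lt_of_le (by positivity) h1
        have := hψ.2 h h0
        have := hψ.1 _ _ (by positivity) h1
        have := hpow n
        gcongr
      refine (Finset.sum_le_card_nsmul _ _ _ hterm).trans ?_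
      have hsplit : ((2 : ℝ) ^ n) ^ (2 - s) = 2 ^ n * ((2 : ℝ) ^ n) ^ (1 - s) := by
        rw [show (2 : ℝ) - s = 1 + (1 - s) by ring, Real.rpow_add (by positivity), Real.rpow_one]
      rw [Nat.card_Ico, nsmul_eq_mul, pow_succ 2 n, mul_two, Nat.add_sub_cancel, pow_succ,
        Real.mul_rpow (by positivity) (by norm_num), hsplit]
      push_cast
      have h2 : (2 : ℝ) ^ (1 - s) ≤ 2 := by
        simpa using Real.rpow_le_rpow_of_exponent_le one_le_two (show 1 - s ≤ 1 by linarith)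
      have := hpow n
      have h3 : 0 ≤ (2 : ℝ) ^ n * (((2 : ℝ) ^ n) ^ (1 - s) * ψ (2 ^ n) ^ (s + 1)) := by positivity
      nlinarith [mul_le_mul_of_nonneg_right h2 h3]
  refine hdiv (summable_of_sum_range_le (c := ∑' t : ℕ, 2 * (((2 : ℝ) ^ t) ^ (2 - s) *
    ψ (2 ^ t) ^ (s + 1))) hnonneg fun n => ?_)
  refine (Finset.sum_le_sum_of_subset_of_nonneg
    (Finset.range_mono (Nat.lt_two_pow_self (n := n)).le) fun h _ _ => hnonneg h).trans
    ((hblock n).trans ((hsum.mul_left 2).sum_le_tsum _ fun t _ => ?_))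
  have := hpow t
  positivity

theorem exists_dyadic_scales (hψ : IsApproxFun ψ) (hs : 1 / 2 < s) (hs1 : s < 1)
    (hdiv : ¬ Summable (fun h : ℕ => (h : ℝ) ^ (1 - s) * ψ h ^ (s + 1))) :
    ∃ (φ : ℕ → ℝ) (σ : ℝ) (T : Set ℕ), σ < 1 ∧ (∀ t, 0 < φ t) ∧ Antitone φ ∧
      (∀ t, φ t ≤ ψ (2 ^ t)) ∧ (∀ t, φ t ^ 2 * 2 ^ t ≤ 1) ∧
      (∀ t ∈ T, ((2 : ℝ) ^ t) ^ (-σ) ≤ φ t) ∧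
      ∀ (t₀ : ℕ) (S : ℝ), ∃ F : Finset ℕ, (∀ t ∈ F, t ∈ T ∧ t₀ ≤ t) ∧
        S ≤ ∑ t ∈ F, ((2 : ℝ) ^ t) ^ (2 - s) * φ t ^ (s + 1) := by
  classical
  obtain ⟨τ, hτ⟩ : ∃ τ, τ = (2 - s) / (1 + s) := ⟨_, rfl⟩
  have hτs : τ * (s + 1) = 2 - s := by rw [hτ]; field_simp; ring
  have hτ1 : τ < 1 := by rw [hτ, div_lt_one (by linarith)]; linarith
  have hτ2 : 1 / 2 < τ := by rw [hτ, lt_div_iff₀ (by linarith)]; linarith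
  have hone : ∀ t : ℕ, (1 : ℝ) ≤ 2 ^ t := fun t => one_le_pow₀ one_le_two
  have hpos : ∀ t : ℕ, (0 : ℝ) < 2 ^ t := fun t => by positivity
  have hψpos : ∀ t : ℕ, 0 < ψ (2 ^ t) := fun t => hψ.2 _ (hpos t)
  set φ : ℕ → ℝ := fun t => min (ψ (2 ^ t)) (((2 : ℝ) ^ t) ^ (-τ)) with hφ
  set b : ℕ → ℝ := fun t => ((2 : ℝ) ^ t) ^ (2 - s) * φ t ^ (s + 1) with hb
  set σ := (τ + 1) / 2 with hσ
  have hφpos : ∀ t, 0 < φ t := fun t => lt_min (hψpos t) (by positivity)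
  have hbpos : ∀ t, 0 ≤ b t := fun t => by have := hφpos t; positivity
  have hφle : ∀ t, φ t ≤ ((2 : ℝ) ^ t) ^ (-τ) := fun t => min_le_right _ _
  set T : Set ℕ := {t | ((2 : ℝ) ^ t) ^ (-σ) ≤ ψ (2 ^ t)} with hT
  have hnb : ¬ Summable b := by
    intro hsum
    refine not_summable_two_pow hψ (by linarith) hs1 hdiv ?_
    refine (summable_congr_atTop ?_).1 hsum
    filter_upwards [hsum.tendsto_atTop_zero.eventually_lt_const one_pos] with t ht
    rcases le_total (ψ (2 ^ t)) (((2 : ℝ) ^ t) ^ (-τ)) with h | h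
    · simp only [hb, hφ, min_eq_left h]
    · exfalso
      simp only [hb, hφ, min_eq_right h] at ht
      rw [← Real.rpow_mul (hpos t).le, ← Real.rpow_add (hpos t),
        show 2 - s + -τ * (s + 1) = 0 by linarith, Real.rpow_zero] at ht
      exact lt_irrefl _ ht
  have hnT : ¬ Summable (T.indicator b) := by
    intro hsum
    have hgeo : Summable fun t : ℕ => ((2 : ℝ) ^ (2 - s - σ * (s + 1))) ^ t := by
      refine summable_geometric_of_lt_one (by positivity)
        (Real.rpow_lt_one_of_one_lt_of_neg one_lt_two ?_)
      nlinarith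
    refine hnb (Summable.of_nonneg_of_le hbpos (fun t => ?_) (hsum.add hgeo))
    by_cases ht : t ∈ T
    · rw [indicator_of_mem ht]
      exact le_add_of_nonneg_right (by positivity)
    · rw [indicator_of_notMem ht, zero_add, ← Real.rpow_natCast, ← Real.rpow_mul zero_le_two,
        mul_comm, Real.rpow_mul zero_le_two, Real.rpow_natCast,
        show 2 - s - σ * (s + 1) = 2 - s + -σ * (s + 1) by ring, Real.rpow_add (hpos t),
        Real.rpow_mul (hpos t).le]
      have h1 : φ t ≤ ((2 : ℝ) ^ t) ^ (-σ) := (min_le_left _ _).trans (not_le.1 ht).le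
      have := hφpos t
      simp only [hb]
      gcongr
  refine ⟨φ, σ, T, by linarith, hφpos, antitone_nat_of_succ_le fun t => ?_,
    fun t => min_le_left _ _, fun t => ?_, fun t ht => ?_, fun t₀ S => ?_⟩
  · refine min_le_min (hψ.1 _ _ (hpos t) (pow_le_pow_right₀ one_le_two t.le_succ)) ?_
    exact Real.rpow_le_rpow_of_nonpos (hpos t) (pow_le_pow_right₀ one_le_two t.le_succ)
      (by linarith)
  · have h1 : φ t ^ 2 ≤ (((2 : ℝ) ^ t) ^ (-τ)) ^ 2 := by
      have := hφpos t
      gcongr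
      exact hφle t
    refine (mul_le_mul_of_nonneg_right h1 (hpos t).le).trans ?_
    rw [← Real.rpow_mul_natCast (hpos t).le]
    nth_rewrite 2 [← Real.rpow_one ((2 : ℝ) ^ t)]
    rw [← Real.rpow_add (hpos t)]
    refine Real.rpow_le_one_of_one_le_of_nonpos (hone t) ?_
    push_cast
    linarith
  · exact le_min ht (Real.rpow_le_rpow_of_exponent_le (hone t) (by linarith))
  · rw [not_summable_iff_tendsto_nat_atTop_of_nonneg
      fun t => indicator_nonneg (fun t _ => hbpos t) t] at hnT
    obtain ⟨n, hn, hn'⟩ := ((hnT.eventually_ge_atTop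
      (S + ∑ t ∈ Finset.range t₀, T.indicator b t)).and (eventually_ge_atTop t₀)).exists
    refine ⟨(Finset.Ico t₀ n).filter (· ∈ T), fun t ht => ?_, ?_⟩
    · rw [Finset.mem_filter, Finset.mem_Ico] at ht
      exact ⟨ht.2, ht.1.1⟩
    · rw [← Finset.sum_range_add_sum_Ico _ hn'] at hn
      rw [Finset.sum_filter]
      simp only [indicator_apply] at hn
      linarith

end DyadicScales

section Arc

open Set
open scoped Topology

variable {ψ f g h : ℝ → ℝ} {s α β m M : ℝ}

theorem IsConvexArc.hausdorffMeasure_eq_top (H : IsConvexArc f g h α β m M) (hαβ : α < β)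
    (hψ : IsApproxFun ψ) (hs : 1 / 2 < s) (hs1 : s < 1)
    (hdiv : ¬ Summable (fun h : ℕ => (h : ℝ) ^ (1 - s) * ψ h ^ (s + 1))) :
    μH[s] {x | x ∈ Icc α β ∧ ∀ k : ℕ, x ∈ {x : ℝ | ∃ q : ℕ, k ≤ q ∧ 0 < q ∧
      max (distNearestInt (q * x)) (distNearestInt (q * f x)) < ψ q}} = ⊤ := by
  obtain ⟨φ, σ, T, hσ, hφ, hφanti, hφψ, hφ2, hφT, hF⟩ := exists_dyadic_scales hψ hs hs1 hdiv
  have hm := H.pos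
  have hm1 := H.le_one
  have hM1 := H.one_le
  have hM : 0 < M := by linarith
  have hs0 : 0 < s := by linarith
  obtain ⟨κ, hκ⟩ : ∃ κ, κ = (m / (288 * M)) ^ 2 / 2 := ⟨_, rfl⟩
  have hκ0 : 0 < κ := by rw [hκ]; positivity
  have hmM : m / (288 * M) ≤ 1 / 288 := by
    rw [div_le_div_iff₀ (by positivity) (by norm_num)]
    linarith
  have hκ8 : κ ≤ 1 / 8 := by
    have : 0 < m / (288 * M) := by positivity
    rw [hκ]
    nlinarith
  have hκM : 288 * (M / m) * √(2 * κ) ≤ 1 := by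
    rw [hκ, mul_div_cancel₀ _ two_ne_zero, Real.sqrt_sq (by positivity)]
    apply le_of_eq
    field_simp
  set Q : ℕ → ℝ := fun t => κ ^ 2 / 4 * 2 ^ t with hQ
  have hQ0 : ∀ t, 0 < Q t := fun t => by positivity
  have hQle : ∀ t, Q t ≤ 2 ^ t := fun t => by
    have : (0 : ℝ) < 2 ^ t := by positivity
    refine mul_le_of_le_one_left this.le ?_
    nlinarith
  set r : ℕ → ℝ := fun t => κ ^ 2 / (16 * M) * φ t / Q t with hr
  set d : ℕ → ℝ := fun t => 1 / (φ t * Q t ^ 2) with hd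
  have hr0 : ∀ t, 0 < r t := fun t => by have := hφ t; have := hQ0 t; positivity
  have hrr : ∀ t, r (t + 1) ≤ r t / 2 := fun t => by
    have h1 : Q (t + 1) = Q t * 2 := by simp only [hQ, pow_succ]; ring
    have h2 := hφanti t.le_succ
    have := hQ0 t
    simp only [hr, h1, div_div]
    gcongr
  have hφQ2 : ∀ t, φ t ^ 2 * Q t ≤ 1 := fun t =>
    (mul_le_mul_of_nonneg_left (hQle t) (sq_nonneg _)).trans (hφ2 t)
  have hrd : ∀ t, r t ≤ d t := fun t => by
    have h1 := hφ t
    have h2 := hQ0 t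
    have h3 : κ ^ 2 / (16 * M) ≤ 1 := by
      rw [div_le_one (by positivity)]
      nlinarith
    simp only [hr, hd]
    rw [div_le_div_iff₀ h2 (by positivity)]
    have h4 : κ ^ 2 / (16 * M) * (φ t ^ 2 * Q t) ≤ 1 :=
      mul_le_one₀ h3 (by positivity) (hφQ2 t)
    nlinarith
  have hrsd : ∀ t, r t ^ s / d t = (κ ^ 2 / (16 * M) / (κ ^ 2 / 4)) ^ s * (κ ^ 2 / 4) ^ 2 *
      (((2 : ℝ) ^ t) ^ (2 - s) * φ t ^ (s + 1)) := fun t => by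
    have h1 := hφ t
    have h2 : (0 : ℝ) < 2 ^ t := by positivity
    simp only [hr, hd, hQ]
    rw [show κ ^ 2 / (16 * M) * φ t / (κ ^ 2 / 4 * 2 ^ t) =
      κ ^ 2 / (16 * M) / (κ ^ 2 / 4) * (φ t / 2 ^ t) by field_simp,
      Real.mul_rpow (by positivity) (by positivity), Real.div_rpow h1.le h2.le,
      Real.rpow_sub h2, Real.rpow_add_one h1.ne', Real.rpow_two]
    field_simp
  have hdiv' : ∀ (t₀ : ℕ) (S : ℝ), ∃ F : Finset ℕ, (∀ t ∈ F, t ∈ T ∧ t₀ ≤ t) ∧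
      S ≤ ∑ t ∈ F, r t ^ s / d t := by
    intro t₀ S
    obtain ⟨F, hFT, hFS⟩ := hF t₀ (S / ((κ ^ 2 / (16 * M) / (κ ^ 2 / 4)) ^ s * (κ ^ 2 / 4) ^ 2))
    refine ⟨F, hFT, ?_⟩
    simp only [hrsd]
    rwa [← Finset.mul_sum, ← div_le_iff₀' (by positivity)]
  have hpow : Tendsto (fun t : ℕ => (2 : ℝ) ^ t) atTop atTop :=
    tendsto_pow_atTop_atTop_of_one_lt one_lt_two
  have hQtop : Tendsto Q atTop atTop := hpow.const_mul_atTop (by positivity)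
  have hQσ : Tendsto (fun t : ℕ => κ ^ 2 / 4 * ((2 : ℝ) ^ t) ^ (1 - σ)) atTop atTop :=
    ((tendsto_rpow_atTop (by linarith)).comp hpow).const_mul_atTop (by positivity)
  have hφQ : ∀ t ∈ T, κ ^ 2 / 4 * ((2 : ℝ) ^ t) ^ (1 - σ) ≤ φ t * Q t := fun t ht => by
    have h2 : (0 : ℝ) < 2 ^ t := by positivity
    rw [sub_eq_add_neg, Real.rpow_add h2, Real.rpow_one]
    have := mul_le_mul_of_nonneg_left (hφT t ht) (hQ0 t).le
    simp only [hQ] at this ⊢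
    linarith
  refine hausdorffMeasure_eq_top_of_weighted_intervals (ι := (_ : ℕ) × ℤ) (C := 1 / (1 / 12))
    hs0 hs1 (by norm_num) hαβ fun a b k δ ha hab hb hδ => ?_
  refine exists_weighted_intervals hs0 hs1 (by norm_num) hr0 hrr hrd hdiv' hab ?_ hδ
  have hlen := sub_pos.2 hab
  have hev := (((hQtop.eventually_ge_atTop 1).and (hQtop.eventually_ge_atTop
    (8 / (m * (b - a) ^ 2)))).and (hQtop.eventually_ge_atTop ((k + 1) / κ))).and
    (((hQσ.eventually_ge_atTop 1).and (hQσ.eventually_ge_atTop (8 / (b - a)))).and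
      (hQσ.eventually_ge_atTop (64 * M / κ ^ 2)))
  obtain ⟨t₀, ht₀⟩ := eventually_atTop.1 hev
  refine ⟨t₀, fun t htT ht => ?_⟩
  obtain ⟨⟨⟨e1, e2⟩, e3⟩, ⟨e4, e5⟩, e6⟩ := ht₀ t ht
  have hφQt := hφQ t htT
  have hφt := hφ t
  have hφ1 : φ t ≤ 1 := by nlinarith [hφQ2 t]
  have f4 := e4.trans hφQt
  have f5 := e5.trans hφQt
  have f6 := e6.trans hφQt
  rw [div_le_iff₀ (by positivity)] at e2 e3 f5 f6
  have hcube : φ t * Q t ≤ (φ t * Q t) ^ 3 := by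
    have := pow_le_pow_right₀ f4 (show 1 ≤ 3 by norm_num)
    simpa using this
  obtain ⟨J, p, hJ, hp⟩ := (H.mono ha hb).exists_finset_distNearestInt_lt hab hφt hφ1 e1 f4 f5 e2
    (hφQ2 t) (by nlinarith [mul_le_mul_of_nonneg_left hcube (sq_nonneg κ)]) hκ0 hκ8 hκM
    (d := d t) (r := r t) rfl rfl (hrd t)
  refine ⟨J, p, by linarith, fun j hj => ?_⟩
  obtain ⟨h1, h2, q, hq1, hq2, hq⟩ := hp j hj
  refine ⟨h1, subset_inter h2 fun y hy => ?_⟩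
  have hkq : (k : ℝ) + 1 ≤ q := by linarith
  have hkq' : k + 1 ≤ q := by exact_mod_cast hkq
  have hq2' : (q : ℝ) ≤ 2 ^ t := by
    refine hq2.trans (le_of_eq ?_)
    simp only [hQ]
    field_simp
  have hq0 : 0 < q := by omega
  have hφq : φ t ≤ ψ q := (hφψ t).trans (hψ.1 _ _ (by exact_mod_cast hq0) hq2')
  exact ⟨q, by omega, hq0, max_lt ((hq y hy).1.trans_le hφq) ((hq y hy).2.trans_le hφq)⟩

end Arc

section Curve

open Set
open scoped Topology

theorem distNearestInt_neg (z : ℝ) : distNearestInt (-z) = distNearestInt z := by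
  have key : ∀ z : ℝ, distNearestInt (-z) ≤ distNearestInt z := fun z => by
    refine (distNearestInt_le (-z) (-round z)).trans (le_of_eq ?_)
    rw [distNearestInt, ← abs_neg]
    congr 1
    push_cast
    ring
  exact le_antisymm (key z) (by simpa using key (-z))

theorem exists_interior_iteratedDerivWithin_two_ne_zero {I : Set ℝ} (hI : I.OrdConnected)
    {f : ℝ → ℝ} (hf : ContDiffOn ℝ 2 f I) (hnd : ∃ x ∈ I, iteratedDerivWithin 2 f I x ≠ 0) :
    ∃ x ∈ interior I, iteratedDerivWithin 2 f I x ≠ 0 := by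
  obtain ⟨x₀, hx₀, hne⟩ := hnd
  have hint : (interior I).Nonempty := by
    rw [← hI.convex.nontrivial_iff_nonempty_interior]
    by_contra hsub
    rw [not_nontrivial_iff] at hsub
    refine hne ?_
    rw [iteratedDerivWithin_succ, hsub.eq_singleton_of_mem hx₀]
    refine derivWithin_zero_of_not_accPt fun hacc => ?_
    obtain ⟨y, hy, hyne⟩ := accPt_iff_nhds.1 hacc univ Filter.univ_mem
    exact hyne hy.2
  have hcont := hf.continuousOn_iteratedDerivWithin le_rfl (uniqueDiffOn_convex hI.convex hint)
  have hmem := (hcont x₀ hx₀).eventually_ne hne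
  rw [eventually_nhdsWithin_iff] at hmem
  have hcl : x₀ ∈ closure (interior I) := by
    rw [Convex.closure_interior_eq_closure_of_nonempty_interior (𝕜 := ℝ) hI.convex hint]
    exact subset_closure hx₀
  obtain ⟨x, hx, hxI⟩ := mem_closure_iff_nhds.1 hcl _ hmem
  exact ⟨x, hxI, hx (interior_subset hxI)⟩

theorem exists_isConvexArc {I : Set ℝ} (hI : I.OrdConnected) {f : ℝ → ℝ}
    (hf : ContDiffOn ℝ 2 f I) (hnd : ∃ x ∈ I, iteratedDerivWithin 2 f I x ≠ 0) :
    ∃ e g h α β m M, (e = 1 ∨ e = -1) ∧ α < β ∧ Icc α β ⊆ I ∧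
      IsConvexArc (fun x => e * f x) g h α β m M := by
  obtain ⟨x₁, hx₁, hne⟩ := exists_interior_iteratedDerivWithin_two_ne_zero hI hf hnd
  have hopen : IsOpen (interior I) := isOpen_interior
  have hf0 : ContDiffOn ℝ 2 f (interior I) := hf.mono interior_subset
  have hf1 : ContDiffOn ℝ 1 (deriv f) (interior I) := hf0.deriv_of_isOpen hopen (by norm_num)
  have hf2 : ContDiffOn ℝ 0 (deriv (deriv f)) (interior I) :=
    hf1.deriv_of_isOpen hopen (by norm_num)
  have hd0 : ∀ x ∈ interior I, HasDerivAt f (deriv f x) x := fun x hx =>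
    ((hf0.differentiableOn (by norm_num)).differentiableAt (hopen.mem_nhds hx)).hasDerivAt
  have hd1 : ∀ x ∈ interior I, HasDerivAt (deriv f) (deriv (deriv f) x) x := fun x hx =>
    ((hf1.differentiableOn (by norm_num)).differentiableAt (hopen.mem_nhds hx)).hasDerivAt
  have hne2 : deriv (deriv f) x₁ ≠ 0 := by
    have hcongr : iteratedDerivWithin 1 f I =ᶠ[𝓝 x₁] deriv f := by
      filter_upwards [hopen.mem_nhds hx₁] with x hx
      rw [iteratedDerivWithin_one, derivWithin_of_mem_nhds (mem_interior_iff_mem_nhds.1 hx)]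
    rwa [iteratedDerivWithin_succ, derivWithin_of_mem_nhds (mem_interior_iff_mem_nhds.1 hx₁),
      hcongr.deriv_eq] at hne
  obtain ⟨e, he, hpos⟩ : ∃ e : ℝ, (e = 1 ∨ e = -1) ∧ 0 < e * deriv (deriv f) x₁ := by
    rcases lt_or_gt_of_ne hne2 with h | h
    · exact ⟨-1, Or.inr rfl, by linarith⟩
    · exact ⟨1, Or.inl rfl, by linarith⟩
  set c := e * deriv (deriv f) x₁ / 2 with hc
  have hev : ∀ᶠ x in 𝓝 x₁, x ∈ interior I ∧ c < e * deriv (deriv f) x :=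
    (hopen.eventually_mem hx₁).and (((hf2.continuousOn.continuousAt
      (hopen.mem_nhds hx₁)).const_mul e).eventually_const_lt (by linarith))
  obtain ⟨ε, hε, hball⟩ := Metric.nhds_basis_closedBall.eventually_iff.1 hev
  rw [Real.closedBall_eq_Icc] at hball
  have hsub : Icc (x₁ - ε) (x₁ + ε) ⊆ interior I := fun x hx => (hball hx).1
  obtain ⟨B₁, hB₁⟩ := isCompact_Icc.exists_bound_of_continuousOn (hf1.continuousOn.mono hsub)
  obtain ⟨B₂, hB₂⟩ := isCompact_Icc.exists_bound_of_continuousOn (hf2.continuousOn.mono hsub)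
  have habs : ∀ z : ℝ, |e * z| = |z| := fun z => by
    rcases he with rfl | rfl <;> simp
  refine ⟨e, fun x => e * deriv f x, fun x => e * deriv (deriv f) x, x₁ - ε, x₁ + ε, min c 1,
    max 1 (max B₁ B₂), he, by linarith, hsub.trans interior_subset, ?_⟩
  exact
    { pos := lt_min (by positivity) one_pos
      le_one := min_le_right _ _
      one_le := le_max_left _ _
      hasDerivAt := fun x hx => (hd0 x (hsub hx)).const_mul e
      hasDerivAt_deriv := fun x hx => (hd1 x (hsub hx)).const_mul e
      le_second := fun x hx => (min_le_left _ _).trans (hball hx).2.le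
      second_le := fun x hx => by
        refine (le_abs_self _).trans ?_
        rw [habs]
        exact (hB₂ x hx).trans ((le_max_right _ _).trans (le_max_right _ _))
      abs_deriv_le := fun x hx => by
        rw [habs]
        exact (hB₁ x hx).trans ((le_max_left _ _).trans (le_max_right _ _)) }

end Curve

theorem hausdorff_measure_divergence_on_curve
    (I₀ : Set ℝ) (hI₀ : I₀.OrdConnected)
    (f : ℝ → ℝ) (hf : ContDiffOn ℝ 3 f I₀)
    (hnd : ∃ x₀ ∈ I₀, iteratedDerivWithin 2 f I₀ x₀ ≠ 0)
    (s : ℝ) (hs : s ∈ Set.Ioo (1/2 : ℝ) 1)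
    (ψ : ℝ → ℝ) (hψ : IsApproxFun ψ)
    (hdiv : ¬ Summable (fun h : ℕ => (h : ℝ) ^ (1 - s) * ψ h ^ (s + 1))) :
    μH[s] (((fun x => (x, f x)) '' I₀) ∩ SimApprox2 ψ) = ⊤ := by
  obtain ⟨e, g, h, α, β, m, M, he, hαβ, hsub, H⟩ :=
    exists_isConvexArc hI₀ (hf.of_le (by norm_num)) hnd
  have htop := H.hausdorffMeasure_eq_top hαβ hψ hs.1 hs.2 hdiv
  have hdist : ∀ z : ℝ, distNearestInt (e * z) = distNearestInt z := fun z => by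
    rcases he with rfl | rfl
    · rw [one_mul]
    · rw [neg_one_mul, distNearestInt_neg]
  have hlip := (LipschitzWith.prod_fst (α := ℝ) (β := ℝ)).hausdorffMeasure_image_le
    (show 0 ≤ s by linarith [hs.1]) (((fun x => (x, f x)) '' I₀) ∩ SimApprox2 ψ)
  rw [ENNReal.coe_one, ENNReal.one_rpow, one_mul] at hlip
  refine top_le_iff.1 (le_trans ?_ hlip)
  rw [← htop]
  refine measure_mono fun x hx => ⟨(x, f x), ⟨⟨x, hsub hx.1, rfl⟩, ?_⟩, rfl⟩
  refine Set.infinite_of_forall_exists_gt fun k => ?_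
  obtain ⟨q, hkq, hq0, hq⟩ := hx.2 (k + 1)
  refine ⟨q, ⟨hq0, ?_⟩, hkq⟩
  rwa [mul_left_comm, hdist] at hq
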